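/- arXiv:2305.06270 — 8 statements merged into one kernel-verified Lean document; each statement's English description precedes it below -/
import Mathlib

section
/- Let G be a finite simple graph on vertex set {t_1,…,t_s} with at least one edge and let I = I(G) ⊆ S = K[t_1,…,t_s] be its edge ideal. Then G is bipartite (contains no odd cycle) if and only if for every integer k ≥ 1 one has I^k = p_1^k ∩ ⋯ ∩ p_r^k, where p_1,…,p_r are the minimal primes of I; that is, the ordinary and symbolic powers of I coincide for all k. -/
open MvPolynomial

namespace SimpleGraph

variable {V : Type*} {G : SimpleGraph V}

/-- If there is no odd cycle, then removing the detours of a walk preserves the parity of its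
length. -/
lemma Walk.even_length_add_length_bypass [DecidableEq V]
    (h : ∀ (v : V) (w : G.Walk v v), w.IsCycle → ¬ Odd w.length) {u v : V} (w : G.Walk u v) :
    Even (w.length + w.bypass.length) := by
  induction w with
  | nil => simp [Walk.bypass]
  | @cons u v' v hadj p ih =>
    simp only [Walk.bypass]
    split_ifs with hs
    · have hlen := congrArg Walk.length (p.bypass.take_spec hs)
      rw [Walk.length_append] at hlen
      have hpath : (p.bypass.takeUntil u hs).IsPath := p.bypass_isPath.takeUntil hs
      have hpos : (p.bypass.takeUntil u hs).length ≠ 0 := fun h0 ↦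
        hadj.ne (Walk.eq_of_length_eq_zero h0).symm
      have heven : Even ((p.bypass.takeUntil u hs).length + 1) := by
        by_cases h3 : 3 ≤ (p.bypass.takeUntil u hs).length + 1
        · have hc : (Walk.cons hadj (p.bypass.takeUntil u hs)).IsCycle := by
            rw [Walk.isCycle_iff_isPath_tail_and_le_length]
            exact ⟨by simpa using hpath, by simpa using h3⟩
          simpa using h _ _ hc
        · rw [show (p.bypass.takeUntil u hs).length + 1 = 2 by omega]
          exact even_two
      rw [Walk.length_cons]
      rw [Nat.even_iff] at *
      omega
    · rw [Walk.length_cons, Walk.length_cons]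
      rw [Nat.even_iff] at *
      omega

/-- A graph without odd cycles is two-colorable. -/
lemma two_colorable_of_forall_isCycle_not_odd
    (h : ∀ (v : V) (w : G.Walk v v), w.IsCycle → ¬ Odd w.length) : G.Colorable 2 := by
  classical
  rw [two_colorable_iff_forall_loop_even]
  intro u w
  have h0 : w.bypass.length = 0 := by
    rw [Walk.length_eq_zero_iff]
    exact Walk.isPath_iff_nil.mp w.bypass_isPath
  simpa [h0] using Walk.even_length_add_length_bypass h w

/-- A vertex cover contains at least half of the steps of a closed walk. -/
lemma Walk.length_add_le_two_mul_countP (C : V → Prop) [DecidablePred C]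
    (hC : ∀ i j, G.Adj i j → C i ∨ C j) {u v : V} (w : G.Walk u v) :
    w.length + (if C v then 1 else 0) ≤
      2 * w.support.tail.countP C + (if C u then 1 else 0) := by
  induction w with
  | nil => simp
  | @cons u v' v hadj p ih =>
    have := hC _ _ hadj
    rw [Walk.support_cons, List.tail_cons, ← p.cons_tail_support, List.countP_cons,
      Walk.length_cons]
    simp only [decide_eq_true_eq]
    by_cases hu : C u <;> by_cases hv : C v' <;> simp_all <;> omega

/-- A finite set of vertices meeting every edge. -/
def IsVertexCoverFinset (G : SimpleGraph V) (C : Finset V) : Prop :=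
  ∀ i j, G.Adj i j → i ∈ C ∨ j ∈ C

/-- Given a two-coloring, the join of two vertex covers with respect to the order comparing them
on the `b`-colored vertices. -/
def coverJoin [DecidableEq V] (c : V → Bool) (b : Bool) (C D : Finset V) : Finset V :=
  (C ∪ D).filter fun i ↦ c i = b ∨ (i ∈ C ∧ i ∈ D)

lemma mem_coverJoin [DecidableEq V] {c : V → Bool} {b : Bool} {C D : Finset V} {i : V} :
    i ∈ coverJoin c b C D ↔ (i ∈ C ∨ i ∈ D) ∧ (c i = b ∨ (i ∈ C ∧ i ∈ D)) := by
  simp [coverJoin]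

lemma IsVertexCoverFinset.coverJoin [DecidableEq V] {c : V → Bool}
    (hc : ∀ i j, G.Adj i j → c i ≠ c j) (b : Bool) {C D : Finset V}
    (hC : G.IsVertexCoverFinset C) (hD : G.IsVertexCoverFinset D) :
    G.IsVertexCoverFinset (coverJoin c b C D) := by
  intro i j hij
  have h1 := hC i j hij
  have h2 := hD i j hij
  have h3 := hc i j hij
  rw [mem_coverJoin, mem_coverJoin]
  cases hi : c i <;> cases hj : c j <;> cases b <;> simp_all <;> tauto

lemma sum_coverJoin_add_sum_coverJoin_not [DecidableEq V] (c : V → Bool) (b : Bool)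
    (C D : Finset V) (a : V → ℕ) :
    ∑ i ∈ SimpleGraph.coverJoin c b C D, a i + ∑ i ∈ SimpleGraph.coverJoin c (!b) C D, a i =
      ∑ i ∈ C, a i + ∑ i ∈ D, a i := by
  rw [← Finset.sum_union_inter (s₁ := C),
    ← Finset.sum_union_inter (s₁ := SimpleGraph.coverJoin c b C D)]
  congr 2 <;>
  · ext i
    simp only [Finset.mem_union, Finset.mem_inter, mem_coverJoin]
    cases c i <;> cases b <;> simp <;> tauto

/-- In a two-colored weighted graph, a vertex `j` of positive weight lying in some vertex cover of
minimum weight has a neighbor of positive weight which shares no minimum cover with `j`. -/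
lemma exists_adj_not_mem_of_mem [Fintype V] [DecidableEq V] {c : V → Bool}
    (hc : ∀ i j, G.Adj i j → c i ≠ c j) (a : V → ℕ) (m : ℕ)
    (hmin : ∀ C, G.IsVertexCoverFinset C → m ≤ ∑ i ∈ C, a i) {C₀ : Finset V}
    (hC₀ : G.IsVertexCoverFinset C₀) (hm : ∑ i ∈ C₀, a i = m) {j : V} (hj : j ∈ C₀)
    (haj : a j ≠ 0) :
    ∃ i, G.Adj i j ∧ a i ≠ 0 ∧ ∀ C, G.IsVertexCoverFinset C → ∑ i ∈ C, a i = m →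
      ¬ (i ∈ C ∧ j ∈ C) := by
  classical
  let F : Finset (Finset V) := Finset.univ.filter fun C ↦
    G.IsVertexCoverFinset C ∧ ∑ i ∈ C, a i = m ∧ j ∈ C
  obtain ⟨C, hCF, hmax⟩ := F.exists_max_image (fun C ↦ (C.filter fun i ↦ c i = !c j).card)
    ⟨C₀, by simp [F, hC₀, hm, hj]⟩
  simp only [F, Finset.mem_filter, Finset.mem_univ, true_and] at hCF hmax
  obtain ⟨hC, hCm, hjC⟩ := hCF
  obtain ⟨i, hij, hai, hiC⟩ : ∃ i, G.Adj i j ∧ a i ≠ 0 ∧ i ∉ C := by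
    by_contra! hno
    let Z : Finset V := Finset.univ.filter fun i ↦ a i = 0
    have hcov : G.IsVertexCoverFinset ((C.erase j) ∪ Z) := by
      intro u v huv
      have huv' := hC u v huv
      have h1 := hno u
      have h2 := hno v
      have h3 := huv.ne
      simp only [Z, Finset.mem_union, Finset.mem_erase, Finset.mem_filter, Finset.mem_univ,
        true_and]
      by_cases hu : u = j
      · subst hu
        have := h2 huv.symm
        tauto
      · by_cases hv : v = j
        · subst hv
          have := h1 huv
          tauto
        · tauto
    have h1 := hmin _ hcov
    have h2 : ∑ i ∈ C.erase j ∪ Z, a i ≤ ∑ i ∈ C.erase j, a i + ∑ i ∈ Z, a i := by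
      rw [← Finset.sum_union_inter]
      exact Nat.le_add_right _ _
    have h3 : ∑ i ∈ Z, a i = 0 := Finset.sum_eq_zero (by simp [Z])
    have h4 := Finset.sum_erase_add C a hjC
    omega
  refine ⟨i, hij, hai, ?_⟩
  rintro D hD hDm ⟨hiD, hjD⟩
  have hJ := hC.coverJoin hc (!c j) hD
  have h1 := hmin _ hJ
  have h2 := hmin _ (hC.coverJoin hc (!!c j) hD)
  have h3 := sum_coverJoin_add_sum_coverJoin_not c (!c j) C D a
  have h4 := hmax _ ⟨hJ, by omega, mem_coverJoin.mpr ⟨.inl hjC, .inr ⟨hjC, hjD⟩⟩⟩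
  have hci : c i = !c j := by
    have := hc i j hij
    cases h : c i <;> cases h' : c j <;> simp_all
  refine absurd (Finset.card_lt_card (s := C.filter fun i ↦ c i = !c j) ?_) (not_lt.mpr h4)
  refine (Finset.ssubset_iff_of_subset ?_).mpr ⟨i, ?_, ?_⟩
  · intro x hx
    simp only [Finset.mem_filter, mem_coverJoin] at hx ⊢
    tauto
  · simp only [Finset.mem_filter, mem_coverJoin]
    tauto
  · simp [hiC]

end SimpleGraph

namespace MvPolynomial

variable {σ K : Type*}

/-- The ideal of polynomials all of whose monomials have weight at least `k`, for the weight
counting the variables in `C`. -/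
def weightAtLeast [CommSemiring K] (C : Finset σ) (k : ℕ) : Ideal (MvPolynomial σ K) where
  carrier := {f | ∀ a ∈ f.support, k ≤ ∑ i ∈ C, a i}
  zero_mem' := by simp
  add_mem' {f g} hf hg a ha := by
    classical
    rcases Finset.mem_union.mp (support_add ha) with h | h
    exacts [hf a h, hg a h]
  smul_mem' f g hg a ha := by
    classical
    obtain ⟨b, -, d, hd, rfl⟩ := Finset.mem_add.mp (support_mul f g ha)
    refine (hg d hd).trans (Finset.sum_le_sum fun i _ ↦ ?_)
    simp

lemma mem_weightAtLeast [CommSemiring K] {C : Finset σ} {k : ℕ} {f : MvPolynomial σ K} :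
    f ∈ weightAtLeast C k ↔ ∀ a ∈ f.support, k ≤ ∑ i ∈ C, a i := Iff.rfl

lemma pow_le_weightAtLeast [CommSemiring K] {C : Finset σ} {l : ℕ} {J : Ideal (MvPolynomial σ K)}
    (hJ : J ≤ weightAtLeast C l) (k : ℕ) : J ^ k ≤ weightAtLeast C (k * l) := by
  classical
  induction k with
  | zero => intro f _ a _; simp
  | succ k ih =>
    rw [pow_succ, Ideal.mul_le]
    intro f hf g hg a ha
    obtain ⟨b, hb, d, hd, rfl⟩ := Finset.mem_add.mp (support_mul f g ha)
    have h1 := ih hf b hb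
    have h2 := hJ hg d hd
    simp only [Finsupp.add_apply, Finset.sum_add_distrib]
    rw [add_mul, one_mul]
    omega

/-- The kernel of the map killing the variables in `C` consists of polynomials all of whose
monomials involve a variable in `C`. -/
lemma ker_aeval_le_weightAtLeast [CommRing K] [DecidableEq σ] (C : Finset σ) :
    RingHom.ker (aeval (R := K) fun i ↦ if i ∈ C then (0 : MvPolynomial σ K) else X i) ≤
      weightAtLeast C 1 := by
  intro f hf a ha
  by_contra hlt
  have h0 : ∀ i ∈ C, a i = 0 := by
    have : ∑ i ∈ C, a i = 0 := by omega
    simpa [Finset.sum_eq_zero_iff] using this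
  have key : ∀ g : MvPolynomial σ K,
      coeff a (aeval (fun i ↦ if i ∈ C then (0 : MvPolynomial σ K) else X i) g) = coeff a g := by
    intro g
    induction g using MvPolynomial.induction_on' with
    | add p q hp hq => rw [map_add, coeff_add, coeff_add, hp, hq]
    | monomial b r =>
      rw [aeval_monomial]
      by_cases hb : ∀ i ∈ C, b i = 0
      · have : (b.prod fun i k ↦ (if i ∈ C then (0 : MvPolynomial σ K) else X i) ^ k) =
            b.prod fun i k ↦ X i ^ k := by
          refine Finsupp.prod_congr fun i hi ↦ ?_
          rw [if_neg fun hiC ↦ Finsupp.mem_support_iff.mp hi (hb i hiC)]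
        rw [this, algebraMap_eq, ← monomial_eq]
      · push Not at hb
        obtain ⟨i, hiC, hbi⟩ := hb
        rw [Finsupp.prod, Finset.prod_eq_zero (Finsupp.mem_support_iff.mpr hbi) (by simp [hiC, hbi]),
          mul_zero, coeff_zero, coeff_monomial, if_neg]
        rintro rfl
        exact hbi (h0 i hiC)
  have := key f
  rw [RingHom.mem_ker.mp hf, coeff_zero] at this
  exact mem_support_iff.mp ha this.symm

lemma prod_map_X_mem_pow [CommSemiring K] (P : Ideal (MvPolynomial σ K))
    [DecidablePred fun i ↦ (X i : MvPolynomial σ K) ∈ P] (l : List σ) :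
    (l.map X).prod ∈ P ^ l.countP fun i ↦ (X i : MvPolynomial σ K) ∈ P := by
  induction l with
  | nil => simp
  | cons i l ih =>
    rw [List.map_cons, List.prod_cons, List.countP_cons]
    by_cases hi : (X i : MvPolynomial σ K) ∈ P
    · simpa [hi, pow_succ, mul_comm] using Ideal.mul_mem_mul hi ih
    · simpa [hi] using Ideal.mul_mem_left _ _ ih

lemma IsHomogeneous.sum_eq [Fintype σ] [CommSemiring K] {f : MvPolynomial σ K} {n : ℕ}
    (hf : f.IsHomogeneous n) {a : σ →₀ ℕ} (ha : a ∈ f.support) : ∑ i, a i = n := by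
  simpa [Finsupp.weight_apply, Finsupp.sum_fintype] using hf (mem_support_iff.mp ha)

lemma isHomogeneous_prod_map_X [CommSemiring K] (l : List σ) :
    ((l.map X).prod : MvPolynomial σ K).IsHomogeneous l.length := by
  induction l with
  | nil => simpa using isHomogeneous_one σ K
  | cons i l ih =>
    rw [List.map_cons, List.prod_cons, List.length_cons, add_comm]
    exact (isHomogeneous_X K i).mul ih

end MvPolynomial

namespace SimpleGraph

variable {V : Type*} {G : SimpleGraph V}

/-- The edge ideal of a graph. -/
noncomputable def edgeIdeal (G : SimpleGraph V) (K : Type*) [CommSemiring K] : Ideal (MvPolynomial V K) :=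
  Ideal.span {f | ∃ i j, G.Adj i j ∧ f = X i * X j}

lemma X_mul_X_mem_edgeIdeal (K : Type*) [CommSemiring K] {i j : V} (h : G.Adj i j) :
    (X i * X j : MvPolynomial V K) ∈ G.edgeIdeal K :=
  Ideal.subset_span ⟨i, j, h, rfl⟩

/-- In a two-colored graph, a monomial lies in the `m`-th power of the edge ideal, where `m` is the
minimum of its weights with respect to vertex covers. -/
lemma monomial_mem_edgeIdeal_pow [Fintype V] {c : V → Bool}
    (hc : ∀ i j, G.Adj i j → c i ≠ c j) (K : Type*) [CommSemiring K] (m : ℕ) (a : V →₀ ℕ) (r : K)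
    (hmin : ∀ C, G.IsVertexCoverFinset C → m ≤ ∑ i ∈ C, a i)
    (hex : ∃ C, G.IsVertexCoverFinset C ∧ ∑ i ∈ C, a i = m) :
    monomial a r ∈ G.edgeIdeal K ^ m := by
  classical
  induction m generalizing a with
  | zero => simp
  | succ m ih =>
    obtain ⟨C, hC, hCm⟩ := hex
    obtain ⟨j, hjC, haj⟩ : ∃ j ∈ C, a j ≠ 0 :=
      Finset.exists_ne_zero_of_sum_ne_zero (by omega)
    obtain ⟨i, hij, hai, hnot⟩ :=
      exists_adj_not_mem_of_mem hc a (m + 1) hmin hC hCm hjC haj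
    let e : V →₀ ℕ := Finsupp.single i 1 + Finsupp.single j 1
    have hea : e ≤ a := by
      intro x
      have := hij.ne
      simp only [e, Finsupp.add_apply, Finsupp.single_apply]
      split_ifs with h1 h2 h2
      · exact absurd (h1.trans h2.symm) this
      · subst h1; omega
      · subst h2; omega
      · omega
    obtain ⟨b, rfl⟩ := exists_add_of_le hea
    have hsum : ∀ D : Finset V, ∑ x ∈ D, (e + b) x =
        ((if i ∈ D then 1 else 0) + (if j ∈ D then 1 else 0)) + ∑ x ∈ D, b x := by
      intro D
      simp [e, Finset.sum_add_distrib, Finsupp.single_apply]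
    have hbmin : ∀ D, G.IsVertexCoverFinset D → m ≤ ∑ x ∈ D, b x := by
      intro D hD
      have h1 := hmin D hD
      have h2 := hnot D hD
      rw [hsum] at h1 h2
      by_cases hi : i ∈ D <;> by_cases hj : j ∈ D <;> simp only [hi, hj, if_true, if_false] at h1 h2
      · simp at h2
        omega
      all_goals omega
    have hb : monomial b r ∈ G.edgeIdeal K ^ m := by
      refine ih b hbmin ⟨C, hC, ?_⟩
      have h1 := hbmin C hC
      rw [hsum, if_pos hjC] at hCm
      omega
    have : monomial (e + b) r = monomial b r * (X i * X j : MvPolynomial V K) := by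
      simp only [X, monomial_mul, e, mul_one]
      rw [add_comm]
    rw [this, pow_succ]
    exact Ideal.mul_mem_mul hb (X_mul_X_mem_edgeIdeal K hij)

/-- In a two-colored graph, the ordinary powers of the edge ideal contain the symbolic ones. -/
lemma iInf_minimalPrimes_pow_le_edgeIdeal_pow [Fintype V] {c : V → Bool}
    (hc : ∀ i j, G.Adj i j → c i ≠ c j) (K : Type*) [Field K] (k : ℕ) :
    ⨅ p ∈ (G.edgeIdeal K).minimalPrimes, p ^ k ≤ G.edgeIdeal K ^ k := by
  classical
  intro f hf
  have hcov : ∀ a ∈ f.support, ∀ C, G.IsVertexCoverFinset C → k ≤ ∑ i ∈ C, a i := by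
    intro a ha C hC
    let Q := RingHom.ker (aeval (R := K) fun i ↦ if i ∈ C then (0 : MvPolynomial V K) else X i)
    have : Q.IsPrime := RingHom.ker_isPrime _
    have hle : G.edgeIdeal K ≤ Q := by
      refine Ideal.span_le.mpr ?_
      rintro _ ⟨i, j, hij, rfl⟩
      have := hC i j hij
      change _ ∈ Q
      rw [RingHom.mem_ker, map_mul, aeval_X, aeval_X]
      rcases this with h | h <;> simp [h]
    obtain ⟨p, hp, hpQ⟩ := Ideal.exists_minimalPrimes_le hle
    have hfp : f ∈ p ^ k := (Submodule.mem_iInf _).mp ((Submodule.mem_iInf _).mp hf p) hp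
    have := pow_le_weightAtLeast (hpQ.trans (ker_aeval_le_weightAtLeast C)) k hfp a ha
    omega
  rw [f.as_sum]
  refine Ideal.sum_mem _ fun a ha ↦ ?_
  obtain ⟨C, hC, hCmin⟩ := Finset.exists_min_image
    (Finset.univ.filter fun C ↦ G.IsVertexCoverFinset C) (fun C ↦ ∑ i ∈ C, a i)
    ⟨Finset.univ, Finset.mem_filter.mpr ⟨Finset.mem_univ _, fun i _ _ ↦ .inl (Finset.mem_univ i)⟩⟩
  simp only [Finset.mem_filter, Finset.mem_univ, true_and] at hC hCmin
  exact Ideal.pow_le_pow_right (hcov a ha C hC)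
    (monomial_mem_edgeIdeal_pow hc K _ a _ hCmin ⟨C, hC, rfl⟩)

/-- The product of the vertices of a closed walk of length `2 * n + 1` is in the symbolic power of
exponent `n + 1` of the edge ideal, but not in the ordinary power. -/
lemma Walk.length_ne_of_iInf_minimalPrimes_pow_le [Fintype V] (K : Type*) [Field K] (n : ℕ)
    (h : ⨅ p ∈ (G.edgeIdeal K).minimalPrimes, p ^ (n + 1) ≤ G.edgeIdeal K ^ (n + 1)) {v : V}
    (w : G.Walk v v) : w.length ≠ 2 * n + 1 := by
  classical
  intro hw
  let f : MvPolynomial V K := (w.support.tail.map X).prod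
  have hf : f ∈ ⨅ p ∈ (G.edgeIdeal K).minimalPrimes, p ^ (n + 1) := by
    refine (Submodule.mem_iInf _).mpr fun p ↦ (Submodule.mem_iInf _).mpr fun hp ↦ ?_
    have hprime : p.IsPrime := hp.1.1
    have hcount := w.length_add_le_two_mul_countP (fun i ↦ (X i : MvPolynomial V K) ∈ p)
      fun i j hij ↦ hprime.mem_or_mem (hp.1.2 (X_mul_X_mem_edgeIdeal K hij))
    exact Ideal.pow_le_pow_right (by omega) (prod_map_X_mem_pow p w.support.tail)
  have hI : G.edgeIdeal K ≤ weightAtLeast Finset.univ 2 := by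
    refine Ideal.span_le.mpr ?_
    rintro _ ⟨i, j, -, rfl⟩ a ha
    exact (((isHomogeneous_X K i).mul (isHomogeneous_X K j)).sum_eq ha).ge
  have hf0 : f ≠ 0 := by
    refine List.prod_ne_zero fun h0 ↦ ?_
    obtain ⟨i, -, hi⟩ := List.mem_map.mp h0
    exact X_ne_zero i hi
  obtain ⟨a, ha⟩ := MvPolynomial.support_nonempty.mpr hf0
  have h1 := pow_le_weightAtLeast hI _ (h hf) a ha
  have h2 := (isHomogeneous_prod_map_X (K := K) w.support.tail).sum_eq ha
  rw [List.length_tail,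
    Walk.length_support] at h2
  omega

end SimpleGraph

/-- For a finite simple graph `G` on `{t_1,…,t_s}` with at least one
edge and edge ideal `I = I(G)`, the graph `G` is bipartite (has no odd cycle) iff the
ordinary and symbolic powers of `I` coincide: `I^k = ⋂ p^k` over the minimal primes `p`
of `I`, for every `k ≥ 1`. -/
theorem edgeIdeal_symbolic_eq_ordinary_iff_bipartite
    {s : ℕ} (K : Type*) [Field K] (G : SimpleGraph (Fin s))
    (hEdge : ∃ i j : Fin s, G.Adj i j)
    (I : Ideal (MvPolynomial (Fin s) K))
    (hI : I = Ideal.span {f : MvPolynomial (Fin s) K | ∃ i j : Fin s, G.Adj i j ∧ f = X i * X j}) :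
    (∀ (v : Fin s) (w : G.Walk v v), w.IsCycle → ¬ Odd w.length) ↔
      (∀ k : ℕ, 1 ≤ k → I ^ k = ⨅ p ∈ I.minimalPrimes, p ^ k) := by
  replace hI : I = G.edgeIdeal K := hI
  subst hI
  constructor
  · intro h k _
    obtain ⟨c⟩ := SimpleGraph.two_colorable_of_forall_isCycle_not_odd h
    refine le_antisymm (le_iInf₂ fun p hp ↦ Ideal.pow_right_mono hp.1.2 k) ?_
    refine SimpleGraph.iInf_minimalPrimes_pow_le_edgeIdeal_pow (c := fun i ↦ c i = 0) ?_ K k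
    intro i j hij
    have := c.valid hij
    simp only [ne_eq, decide_eq_decide]
    omega
  · rintro h v w - ⟨n, hn⟩
    exact w.length_ne_of_iInf_minimalPrimes_pow_le K n (h (n + 1) (by omega)).ge hn
end

section
/- Let G be a finite simple graph on vertex set {t_1,…,t_s} with at least one edge and let I_c(G) ⊆ S = K[t_1,…,t_s] be its ideal of covers. Then G is bipartite (contains no odd cycle) if and only if for every integer k ≥ 1 one has I_c(G)^k = p_1^k ∩ ⋯ ∩ p_r^k, where p_1,…,p_r are the minimal primes of I_c(G); that is, the ordinary and symbolic powers of I_c(G) coincide for all k. -/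
open MvPolynomial

namespace SimpleGraph

variable {V : Type*} {G : SimpleGraph V}

/-- In a graph without odd cycles, removing the detours of a walk preserves the parity of its
length. -/
lemma Walk.even_length_bypass_iff [DecidableEq V]
    (hG : ∀ (v : V) (w : G.Walk v v), w.IsCycle → ¬ Odd w.length) {u v : V} (w : G.Walk u v) :
    Even w.bypass.length ↔ Even w.length := by
  induction w with
  | nil => simp [Walk.bypass]
  | @cons u x v h p ih =>
    rw [Walk.bypass]
    split_ifs with hs
    · have hpath := p.bypass_isPath.takeUntil hs
      have hlen : Even ((p.bypass.takeUntil u hs).length + 1) := by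
        by_cases he : s(u, x) ∈ (p.bypass.takeUntil u hs).edges
        · rw [hpath.length_eq_one_of_mem_edges (Sym2.eq_swap ▸ he)]
          decide
        · rw [← Nat.not_odd_iff_even]
          exact hG u (.cons h (p.bypass.takeUntil u hs))
            ((Walk.cons_isCycle_iff _ h).mpr ⟨hpath, he⟩)
      have hadd := congrArg Walk.length (p.bypass.take_spec hs)
      rw [Walk.length_append] at hadd
      rw [Walk.length_cons]
      grind
    · simp only [Walk.length_cons, Nat.even_add_one, ih]

lemma two_colorable_iff_forall_isCycle_not_odd :
    G.Colorable 2 ↔ ∀ (v : V) (w : G.Walk v v), w.IsCycle → ¬ Odd w.length := by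
  classical
  rw [two_colorable_iff_forall_loop_even]
  refine ⟨fun h v w _ ↦ Nat.not_odd_iff_even.mpr (h v w), fun h v w ↦ ?_⟩
  rw [← Walk.even_length_bypass_iff h, Walk.length_eq_zero_iff.mpr (Walk.isPath_iff_nil.mp w.bypass_isPath)]
  simp

/-- The set `C` meets every edge of `G`. -/
def MeetsEdges (G : SimpleGraph V) (C : Finset V) : Prop :=
  ∀ i j : V, G.Adj i j → i ∈ C ∨ j ∈ C

/-- The ideal generated by the squarefree monomials supported on vertex covers of `G`. -/
noncomputable def coverIdeal (K : Type*) [CommSemiring K] (G : SimpleGraph V) :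
    Ideal (MvPolynomial V K) :=
  Ideal.span {f | ∃ C : Finset V, G.MeetsEdges C ∧ f = ∏ i ∈ C, X i}

end SimpleGraph

namespace MvPolynomial

variable {σ R : Type*}

lemma restrictSupportIdeal_mul_le [CommSemiring R] {s t u : Set (σ →₀ ℕ)} (hs : IsUpperSet s)
    (ht : IsUpperSet t) (hu : IsUpperSet u) (h : ∀ a ∈ s, ∀ b ∈ t, a + b ∈ u) :
    restrictSupportIdeal R s hs * restrictSupportIdeal R t ht ≤ restrictSupportIdeal R u hu := by
  classical
  refine Ideal.mul_le.mpr fun f hf g hg m hm ↦ ?_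
  obtain ⟨a, ha, b, hb, rfl⟩ := Finset.mem_add.mp (support_mul f g hm)
  exact h a (hf ha) b (hg hb)

/-- An ideal generated by variables is prime. -/
lemma isPrime_span_X_image [CommRing R] [IsDomain R] (A : Set σ) :
    (Ideal.span (X '' A : Set (MvPolynomial σ R))).IsPrime := by
  classical
  let φ : MvPolynomial σ R →ₐ[R] MvPolynomial σ R := aeval fun i ↦ if i ∈ A then 0 else X i
  have hφ (f : MvPolynomial σ R) : f - φ f ∈ Ideal.span (X '' A : Set (MvPolynomial σ R)) := by
    induction f using MvPolynomial.induction_on with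
    | C a => simp [φ]
    | add f g hf hg =>
      rw [map_add, add_sub_add_comm]
      exact add_mem hf hg
    | mul_X f i hf =>
      rw [map_mul, show φ (X i) = if i ∈ A then 0 else X i from aeval_X _ i]
      split_ifs with hi
      · rw [mul_zero, sub_zero]
        exact Ideal.mul_mem_left _ _ (Ideal.subset_span ⟨i, hi, rfl⟩)
      · rw [← sub_mul]
        exact Ideal.mul_mem_right _ _ hf
  have hker : Ideal.span (X '' A : Set (MvPolynomial σ R)) = RingHom.ker φ := by
    refine le_antisymm (Ideal.span_le.mpr ?_) fun f hf ↦ ?_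
    · rintro _ ⟨i, hi, rfl⟩
      simp [φ, RingHom.mem_ker, hi]
    · simpa [(RingHom.mem_ker).mp hf] using hφ f
  rw [hker]
  exact RingHom.ker_isPrime _

lemma X_mem_span_X_image_iff [CommSemiring R] [Nontrivial R] {A : Set σ} {i : σ} :
    (X i : MvPolynomial σ R) ∈ Ideal.span (X '' A) ↔ i ∈ A := by
  classical
  rw [mem_ideal_span_X_image]
  simp [support_X, Finsupp.single_apply]

lemma le_add_of_mem_span_X_pair_pow [CommSemiring R] {i j : σ} {k : ℕ}
    {f : MvPolynomial σ R} (hf : f ∈ Ideal.span (X '' {i, j}) ^ k) {m : σ →₀ ℕ}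
    (hm : m ∈ f.support) : k ≤ m i + m j := by
  have hU (k : ℕ) : IsUpperSet {m : σ →₀ ℕ | k ≤ m i + m j} := fun a b hab ha ↦
    le_trans ha (add_le_add (hab i) (hab j))
  have hle₁ : Ideal.span (X '' {i, j}) ≤ restrictSupportIdeal R _ (hU 1) := by
    intro f hf m hm
    obtain ⟨l, hl, hml⟩ := mem_ideal_span_X_image.mp hf m hm
    rw [Set.mem_ofPred]
    rcases hl with rfl | rfl <;> omega
  have hle (k : ℕ) : Ideal.span (X '' {i, j}) ^ k ≤ restrictSupportIdeal R _ (hU k) := by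
    induction k with
    | zero => exact fun f _ m _ ↦ Nat.zero_le _
    | succ k ih =>
      rw [pow_succ]
      refine (Ideal.mul_mono ih hle₁).trans (restrictSupportIdeal_mul_le _ _ _ ?_)
      intro a ha b hb
      simp only [Set.mem_ofPred, Finsupp.add_apply] at ha hb ⊢
      omega
  exact hle k hf hm

lemma X_mul_X_dvd_prod [CommSemiring R] [Fintype σ] {i j : σ} (hij : i ≠ j) :
    (X i * X j : MvPolynomial σ R) ∣ ∏ l, X l := by
  classical
  rw [← Finset.prod_pair (f := fun l ↦ (X l : MvPolynomial σ R)) hij]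
  exact Finset.prod_dvd_prod_of_subset _ _ _ (Finset.subset_univ _)

end MvPolynomial

namespace SimpleGraph

variable {V K : Type*} {G : SimpleGraph V}

lemma coverIdeal_le_span_X_pair [CommSemiring K] {i j : V} (h : G.Adj i j) :
    G.coverIdeal K ≤ Ideal.span (X '' {i, j}) := by
  refine Ideal.span_le.mpr ?_
  rintro _ ⟨C, hC, rfl⟩
  rcases hC i j h with hi | hi
  all_goals
    exact Ideal.mem_of_dvd _ (Finset.dvd_prod_of_mem X hi)
      (Ideal.subset_span ⟨_, by simp, rfl⟩)

lemma exists_adj_span_X_pair_le [Finite V] [CommSemiring K] {P : Ideal (MvPolynomial V K)}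
    [hP : P.IsPrime] (h : G.coverIdeal K ≤ P) :
    ∃ i j, G.Adj i j ∧ Ideal.span (X '' {i, j}) ≤ P := by
  classical
  have := Fintype.ofFinite V
  by_contra! hne
  have hC : G.MeetsEdges {i | X i ∉ P} := by
    intro i j hij
    by_contra! hmem
    refine hne i j hij (Ideal.span_le.mpr ?_)
    simpa [Set.image_pair, Set.insert_subset_iff] using hmem
  obtain ⟨i, hi, hiP⟩ := (hP.prod_mem_iff).mp (h (Ideal.subset_span ⟨_, hC, rfl⟩))
  exact (Finset.mem_filter.mp hi).2 hiP

lemma minimalPrimes_coverIdeal [Finite V] [CommRing K] [IsDomain K] :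
    (G.coverIdeal K).minimalPrimes =
      {p | ∃ i j, G.Adj i j ∧ p = Ideal.span (X '' {i, j})} := by
  ext p
  constructor
  · intro hp
    have := hp.1.1
    obtain ⟨i, j, hij, hle⟩ := exists_adj_span_X_pair_le hp.1.2
    exact ⟨i, j, hij, le_antisymm
      (hp.2 ⟨isPrime_span_X_image _, coverIdeal_le_span_X_pair hij⟩ hle) hle⟩
  · rintro ⟨i, j, hij, rfl⟩
    refine ⟨⟨isPrime_span_X_image _, coverIdeal_le_span_X_pair hij⟩, fun Q hQ hle ↦ ?_⟩
    have := hQ.1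
    obtain ⟨a, b, hab, hle_Q⟩ := exists_adj_span_X_pair_le hQ.2
    have hmem (l : V) (hl : l ∈ ({a, b} : Set V)) : l ∈ ({i, j} : Set V) :=
      X_mem_span_X_image_iff.mp (hle (hle_Q (Ideal.subset_span (Set.mem_image_of_mem X hl))))
    have ha := hmem a (by simp)
    have hb := hmem b (by simp)
    have hne := hab.ne
    have heq : ({i, j} : Set V) = {a, b} := by
      simp only [Set.mem_insert_iff, Set.mem_singleton_iff] at ha hb
      rcases ha with rfl | rfl <;> rcases hb with rfl | rfl
      · exact absurd rfl hne
      · rfl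
      · exact Set.pair_comm _ _
      · exact absurd rfl hne
    rw [heq]
    exact hle_Q

/-- In a bipartite graph, an exponent vector with sum at least `k` along every edge dominates a
sum of `k` vertex covers. -/
lemma monomial_mem_coverIdeal_pow [Finite V] [CommSemiring K] (hG : G.Colorable 2) {k : ℕ}
    {m : V →₀ ℕ} (hm : ∀ i j, G.Adj i j → k ≤ m i + m j) (c : K) :
    monomial m c ∈ G.coverIdeal K ^ k := by
  classical
  have := Fintype.ofFinite V
  obtain ⟨col⟩ := hG
  let C (t : ℕ) : Finset V := {i | if col i = 0 then t < m i else k ≤ m i + t}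
  have hC (t : ℕ) (ht : t ∈ Finset.range k) : G.MeetsEdges (C t) := by
    intro i j hij
    have hcol := col.valid hij
    have hsum := hm i j hij
    simp only [C, Finset.mem_filter, Finset.mem_univ, true_and]
    split_ifs <;> grind
  have hprod : ∏ t ∈ Finset.range k, ∏ i ∈ C t, (X i : MvPolynomial V K) ∈
      G.coverIdeal K ^ k := by
    have h := Ideal.prod_mem_prod (s := Finset.range k) (I := fun _ ↦ G.coverIdeal K)
      fun t ht ↦ Ideal.subset_span ⟨C t, hC t ht, rfl⟩
    simpa using h
  refine Ideal.mem_of_dvd _ ?_ hprod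
  rw [monomial_eq, Finsupp.prod_fintype _ _ (by simp)]
  refine Dvd.dvd.mul_left ?_ _
  simp_rw [C, Finset.prod_filter]
  rw [Finset.prod_comm]
  refine Finset.prod_dvd_prod_of_dvd _ _ fun i _ ↦ ?_
  rw [← Finset.prod_filter, Finset.prod_const]
  refine pow_dvd_pow _ ?_
  split_ifs
  · refine (Finset.card_le_card (t := Finset.range (m i)) ?_).trans (by simp)
    intro t
    simp
  · refine (Finset.card_le_card (t := Finset.Ico (k - m i) k) ?_).trans (by simp; omega)
    intro t
    simp
    omega

lemma colorable_two_of_prod_X_mem [Fintype V] [CommSemiring K] [Nontrivial K]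
    (h : ∏ i, (X i : MvPolynomial V K) ∈ G.coverIdeal K ^ 2) : G.Colorable 2 := by
  classical
  have hU : IsUpperSet {m : V →₀ ℕ | ∃ C, G.MeetsEdges C ∧ ∀ i ∈ C, 1 ≤ m i} := by
    rintro a b hab ⟨C, hC, hCa⟩
    exact ⟨C, hC, fun i hi ↦ (hCa i hi).trans (hab i)⟩
  have hU₂ : IsUpperSet {m : V →₀ ℕ | ∃ C D, G.MeetsEdges C ∧ G.MeetsEdges D ∧
      ∀ i, (if i ∈ C then 1 else 0) + (if i ∈ D then 1 else 0) ≤ m i} := by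
    rintro a b hab ⟨C, D, hC, hD, hCD⟩
    exact ⟨C, D, hC, hD, fun i ↦ (hCD i).trans (hab i)⟩
  have hle : G.coverIdeal K ≤ restrictSupportIdeal K _ hU := by
    refine Ideal.span_le.mpr ?_
    rintro _ ⟨C, hC, rfl⟩ m hm
    refine ⟨C, hC, fun i hi ↦ ?_⟩
    have hX : ∏ i ∈ C, (X i : MvPolynomial V K) ∈ Ideal.span (X '' {i}) :=
      Ideal.mem_of_dvd _ (Finset.dvd_prod_of_mem _ hi) (Ideal.subset_span ⟨i, by simp, rfl⟩)
    obtain ⟨j, rfl, hj⟩ := mem_ideal_span_X_image.mp hX m hm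
    exact Nat.one_le_iff_ne_zero.mpr hj
  have hle₂ : G.coverIdeal K ^ 2 ≤ restrictSupportIdeal K _ hU₂ := by
    rw [pow_two]
    refine (Ideal.mul_mono hle hle).trans (restrictSupportIdeal_mul_le hU hU hU₂ ?_)
    rintro a ⟨C, hC, hCa⟩ b ⟨D, hD, hDb⟩
    refine ⟨C, D, hC, hD, fun i ↦ add_le_add ?_ ?_⟩
    · split_ifs with hi
      exacts [hCa i hi, Nat.zero_le _]
    · split_ifs with hi
      exacts [hDb i hi, Nat.zero_le _]
  have hone : ∏ i, (X i : MvPolynomial V K) = monomial (Finsupp.equivFunOnFinite.symm 1) 1 := by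
    rw [monomial_eq, Finsupp.prod_fintype _ _ (by simp)]
    simp
  have hsupp : Finsupp.equivFunOnFinite.symm 1 ∈ (∏ i, (X i : MvPolynomial V K)).support := by
    rw [hone, mem_support_iff, coeff_monomial, if_pos rfl]
    exact one_ne_zero
  obtain ⟨C, D, hC, hD, hCD⟩ := hle₂ h hsupp
  refine ⟨Coloring.mk (fun i ↦ if i ∈ C then 0 else 1) fun {i j} hij ↦ ?_⟩
  have hi := hCD i
  have hj := hCD j
  have hCij := hC i j hij
  have hDij := hD i j hij
  simp only [Finsupp.equivFunOnFinite_symm_apply_apply, Pi.one_apply] at hi hj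
  split_ifs at * <;> simp_all

end SimpleGraph

/-- For a finite simple graph `G` on `{t_1,…,t_s}` with at least one
edge and ideal of covers `I_c(G)` (generated by the squarefree monomials supported on
vertex covers of `G`), the graph `G` is bipartite (has no odd cycle) iff the ordinary
and symbolic powers of `I_c(G)` coincide for every `k ≥ 1`. -/
theorem coverIdeal_symbolic_eq_ordinary_iff_bipartite
    {s : ℕ} (K : Type*) [Field K] (G : SimpleGraph (Fin s))
    (hEdge : ∃ i j : Fin s, G.Adj i j)
    (Ic : Ideal (MvPolynomial (Fin s) K))
    (hIc : Ic = Ideal.span {f : MvPolynomial (Fin s) K |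
      ∃ C : Finset (Fin s), (∀ i j : Fin s, G.Adj i j → i ∈ C ∨ j ∈ C) ∧
        f = ∏ i ∈ C, X i}) :
    (∀ (v : Fin s) (w : G.Walk v v), w.IsCycle → ¬ Odd w.length) ↔
      (∀ k : ℕ, 1 ≤ k → Ic ^ k = ⨅ p ∈ Ic.minimalPrimes, p ^ k) := by
  change Ic = G.coverIdeal K at hIc
  subst hIc
  rw [← SimpleGraph.two_colorable_iff_forall_isCycle_not_odd,
    SimpleGraph.minimalPrimes_coverIdeal]
  constructor
  · intro hG k _
    refine le_antisymm (le_iInf₂ ?_) fun f hf ↦ ?_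
    · rintro _ ⟨i, j, hij, rfl⟩
      exact Ideal.pow_right_mono (SimpleGraph.coverIdeal_le_span_X_pair hij) k
    · rw [f.as_sum]
      refine sum_mem fun m hm ↦ SimpleGraph.monomial_mem_coverIdeal_pow hG (fun i j hij ↦ ?_) _
      simp only [Ideal.mem_iInf] at hf
      exact le_add_of_mem_span_X_pair_pow (hf _ ⟨i, j, hij, rfl⟩) hm
  · intro h
    refine SimpleGraph.colorable_two_of_prod_X_mem (K := K) ?_
    rw [h 2 (by norm_num)]
    simp only [Ideal.mem_iInf]
    rintro _ ⟨i, j, hij, rfl⟩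
    refine Ideal.mem_of_dvd _ (X_mul_X_dvd_prod hij.ne) ?_
    rw [pow_two]
    exact Ideal.mul_mem_mul (Ideal.subset_span ⟨i, by simp, rfl⟩)
      (Ideal.subset_span ⟨j, by simp, rfl⟩)
end

section
/- Let G be a finite simple graph on vertex set {t_1,…,t_s} and let I = I(G) ⊆ S = K[t_1,…,t_s] be its edge ideal. Then for every integer k ≥ 1, the set of associated primes of the S-module S/I^k is contained in the set of associated primes of S/I^{k+1}; that is, I has the persistence property. -/
open MvPolynomial

/-- `HasEdgePacking G k a` says that the exponent vector `a` dominates the sum of the indicator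
vectors of `k` edges of `G`, counted with multiplicity. -/
def HasEdgePacking {V : Type*} (G : SimpleGraph V) : ℕ → (V →₀ ℕ) → Prop
  | 0, _ => True
  | k + 1, a => ∃ i j b, G.Adj i j ∧ a = .single i 1 + .single j 1 + b ∧ HasEdgePacking G k b

theorem Finsupp.exists_eq_single_add_of_single_add_eq {V : Type*} {x y : V} {b c : V →₀ ℕ}
    (hxy : x ≠ y) (h : single x 1 + b = single y 1 + c) :
    ∃ d, b = single y 1 + d ∧ c = single x 1 + d := by
  classical
  have hle : single y 1 ≤ b := by
    rw [Finsupp.single_le_iff]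
    have := DFunLike.congr_fun h y
    simp [hxy] at this
    omega
  obtain ⟨d, rfl⟩ := exists_add_of_le hle
  refine ⟨d, rfl, ?_⟩
  apply add_left_cancel (a := single y 1)
  rw [← h]
  abel

namespace HasEdgePacking

variable {V : Type*} {G : SimpleGraph V} {m n : ℕ} {a b : V →₀ ℕ}

theorem add_left (h : HasEdgePacking G n a) (c : V →₀ ℕ) : HasEdgePacking G n (c + a) := by
  induction n generalizing a with
  | zero => trivial
  | succ n ih =>
    obtain ⟨i, j, b, hij, rfl, hb⟩ := h
    exact ⟨i, j, c + b, hij, by abel, ih hb⟩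

theorem add_edge {i j : V} (h : HasEdgePacking G n a) (hij : G.Adj i j) :
    HasEdgePacking G (n + 1) (.single i 1 + .single j 1 + a) :=
  ⟨i, j, a, hij, rfl, h⟩

theorem of_succ (h : HasEdgePacking G (n + 1) a) : HasEdgePacking G n a := by
  obtain ⟨i, j, b, -, rfl, hb⟩ := h
  exact hb.add_left _

theorem of_le (h : HasEdgePacking G n a) (hmn : m ≤ n) : HasEdgePacking G m a := by
  induction n, hmn using Nat.le_induction with
  | base => exact h
  | succ n _ ih => exact ih h.of_succ

/-- A packing of `single z 1 + b` either avoids the given copy of `z` or uses an edge at it. -/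
theorem of_single_add {z : V} (h : HasEdgePacking G n (.single z 1 + b)) :
    HasEdgePacking G n b ∨ ∃ u c m, G.Adj z u ∧ b = .single u 1 + c ∧ n = m + 1 ∧
      HasEdgePacking G m c := by
  induction n generalizing b with
  | zero => exact .inl trivial
  | succ n ih =>
    obtain ⟨i, j, c, hij, hbc, hc⟩ := h
    by_cases hzi : z = i
    · subst hzi
      rw [add_assoc] at hbc
      exact .inr ⟨j, c, n, hij, add_left_cancel hbc, rfl, hc⟩
    by_cases hzj : z = j
    · subst hzj
      rw [add_comm (Finsupp.single i 1), add_assoc] at hbc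
      exact .inr ⟨i, c, n, hij.symm, add_left_cancel hbc, rfl, hc⟩
    rw [add_assoc] at hbc
    obtain ⟨d, rfl, hd⟩ := Finsupp.exists_eq_single_add_of_single_add_eq hzi hbc
    obtain ⟨e, rfl, rfl⟩ := Finsupp.exists_eq_single_add_of_single_add_eq hzj hd.symm
    rcases ih hc with h | ⟨u, f, m, hzu, rfl, rfl, hf⟩
    · exact .inl ⟨i, j, e, hij, by abel, h⟩
    · exact .inr ⟨u, .single i 1 + .single j 1 + f, m + 1, hzu, by abel, rfl, i, j, f, hij, rfl, hf⟩

/-- An exchange property of packings, in the spirit of Gallai's lemma on maximum matchings. -/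
theorem exchange {x y z : V} {b c : V →₀ ℕ} (hb : HasEdgePacking G n b) (hc : HasEdgePacking G m c)
    (h : .single z 1 + c = .single x 1 + .single y 1 + b) :
    ∃ n' m', n' + m' = n + m ∧ HasEdgePacking G m' (.single z 1 + c) ∧
      ∃ d, HasEdgePacking G n' d ∧ (.single z 1 + c = .single x 1 + .single z 1 + d ∨
        .single z 1 + c = .single y 1 + .single z 1 + d) := by
  induction n generalizing m z b c with
  | zero =>
    by_cases hzx : z = x
    · subst hzx
      exact ⟨0, m, rfl, hc.add_left _, b, trivial, .inr (by rw [h]; abel)⟩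
    rw [add_assoc] at h
    obtain ⟨d, rfl, -⟩ := Finsupp.exists_eq_single_add_of_single_add_eq hzx h
    exact ⟨0, m, rfl, hc.add_left _, d, trivial, .inl (by abel)⟩
  | succ n ih =>
    by_cases hzx : z = x
    · subst hzx
      exact ⟨n + 1, m, rfl, hc.add_left _, b, hb, .inr (by rw [h]; abel)⟩
    by_cases hzy : z = y
    · subst hzy
      exact ⟨n + 1, m, rfl, hc.add_left _, b, hb, .inl h⟩
    have h' := h
    rw [add_assoc] at h'
    obtain ⟨d, rfl, hd⟩ := Finsupp.exists_eq_single_add_of_single_add_eq hzx h'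
    obtain ⟨e, rfl, rfl⟩ := Finsupp.exists_eq_single_add_of_single_add_eq hzy hd.symm
    rcases hb.of_single_add with he | ⟨u, f, k, hzu, rfl, hk, hf⟩
    · exact ⟨n + 1, m, rfl, hc.add_left _, .single y 1 + e, he.add_left _, .inl (by abel)⟩
    obtain rfl : n = k := by omega
    rw [show Finsupp.single x 1 + (Finsupp.single y 1 + (Finsupp.single u 1 + f)) =
      Finsupp.single u 1 + (Finsupp.single x 1 + Finsupp.single y 1 + f) by abel] at hc ⊢
    rcases hc.of_single_add with hc' | ⟨v, g, k, huv, hg, rfl, hg'⟩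
    · exact ⟨n, m + 1, by omega, ⟨z, u, _, hzu, (add_assoc _ _ _).symm, hc'⟩, .single u 1 + .single y 1 + f,
        hf.add_left _, .inl (by abel)⟩
    obtain ⟨n', m', hnm, hm', d, hd, hd'⟩ := ih hf hg' hg.symm
    have hzg := hm'.add_edge hzu
    rw [add_assoc, ← hg] at hzg
    refine ⟨n' + 1, m' + 1, by omega, hzg, _, hd.add_edge huv, ?_⟩
    rw [hg]
    refine hd'.imp (fun h => ?_) (fun h => ?_) <;>
    · rw [h]
      abel

/-- If no packing of `a` has `m + 1` edges, but one of `a` together with the edge `z w` has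
`m + 2` edges, then some packing of `a` with `m` edges misses a neighbor of `z` and a neighbor
of `w`. -/
theorem exists_adj_adj {z w : V} (ha : ¬ HasEdgePacking G (m + 1) a)
    (h : HasEdgePacking G (m + 2) (.single z 1 + (.single w 1 + a))) :
    ∃ u v b, G.Adj z u ∧ G.Adj w v ∧ a = .single u 1 + .single v 1 + b ∧ HasEdgePacking G m b := by
  rcases h.of_single_add with h | ⟨u, b, k, hzu, hb, hk, h⟩
  · rcases h.of_single_add with h | ⟨u, b, k, -, rfl, hk, h⟩
    · exact absurd h.of_succ ha
    · obtain rfl : m + 1 = k := by omega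
      exact absurd (h.add_left _) ha
  obtain rfl : m + 1 = k := by omega
  by_cases hwu : w = u
  · subst hwu
    rw [add_left_cancel hb] at ha
    exact absurd h ha
  obtain ⟨c, rfl, rfl⟩ := Finsupp.exists_eq_single_add_of_single_add_eq hwu hb
  rcases h.of_single_add with h | ⟨v, d, k, hwv, rfl, hk, h⟩
  · exact absurd (h.add_left _) ha
  obtain rfl : m = k := by omega
  exact ⟨u, v, d, hzu, hwv, by abel, h⟩

theorem of_forall_edge_add (hG : ∃ i j, G.Adj i j)
    (h : ∀ i j, G.Adj i j → HasEdgePacking G (n + 1) (.single i 1 + .single j 1 + a)) :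
    HasEdgePacking G n a := by
  cases n with
  | zero => trivial
  | succ m =>
  by_contra ha
  have hmiss {z w : V} (hzw : G.Adj z w) : ∃ u v b, G.Adj z u ∧ G.Adj w v ∧
      a = .single u 1 + .single v 1 + b ∧ HasEdgePacking G m b :=
    exists_adj_adj ha (by simpa only [add_assoc] using h z w hzw)
  have hadj {x y : V} {b : V →₀ ℕ} (hxy : G.Adj x y) (hab : a = .single x 1 + .single y 1 + b)
      (hb : HasEdgePacking G m b) : False := ha ⟨x, y, b, hxy, hab, hb⟩
  have htrans {x y z : V} {b c : V →₀ ℕ} (hb : HasEdgePacking G m b)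
      (hab : a = .single x 1 + .single y 1 + b) (hc : HasEdgePacking G m c)
      (hac : a = .single z 1 + c) : ∃ d, HasEdgePacking G m d ∧
        (a = .single x 1 + .single z 1 + d ∨ a = .single y 1 + .single z 1 + d) := by
    obtain ⟨n', m', hnm, hm', d, hd, hd'⟩ := exchange hb hc (hac.symm.trans hab)
    rw [← hac] at hm' hd'
    have : m' ≤ m := by
      by_contra! hlt
      exact ha (hm'.of_le hlt)
    exact ⟨d, hd.of_le (by omega), hd'⟩
  obtain ⟨p, q, hpq⟩ := hG
  obtain ⟨w, w', b, hpw, -, hb, hb'⟩ := hmiss hpq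
  obtain ⟨z, z', c, hwz, -, hc, hc'⟩ := hmiss hpw.symm
  obtain ⟨u, v, d, hzu, hwv, hd, hd'⟩ := hmiss hwz.symm
  rw [add_assoc] at hb hc
  obtain ⟨e, he, hae | hae⟩ := htrans hd' hd (hc'.add_left _) hc
  · exact hadj hzu.symm hae he
  obtain ⟨f, hf, haf | haf⟩ := htrans he hae (hb'.add_left _) hb
  · exact hadj hwv.symm haf hf
  · exact hadj hwz.symm haf hf

end HasEdgePacking

theorem edgeIdeal_pow_eq_span_monomial {σ K : Type*} [CommSemiring K] (G : SimpleGraph σ) (k : ℕ) :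
    Ideal.span {f : MvPolynomial σ K | ∃ i j, G.Adj i j ∧ f = X i * X j} ^ k =
      Ideal.span ((fun a => monomial a 1) '' {a | HasEdgePacking G k a}) := by
  induction k with
  | zero =>
    rw [pow_zero, Ideal.one_eq_top, eq_comm, Ideal.eq_top_iff_one]
    exact Ideal.subset_span ⟨0, trivial, rfl⟩
  | succ k ih =>
    rw [pow_succ', ih, Ideal.span_mul_span']
    congr 1
    ext f
    simp only [Set.mem_mul, Set.mem_image, Set.mem_ofPred_eq]
    constructor
    · rintro ⟨_, ⟨i, j, hij, rfl⟩, _, ⟨b, hb, rfl⟩, rfl⟩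
      exact ⟨_, ⟨i, j, b, hij, rfl, hb⟩, by simp [X, monomial_mul]⟩
    · rintro ⟨_, ⟨i, j, b, hij, rfl, hb⟩, rfl⟩
      exact ⟨_, ⟨i, j, hij, rfl⟩, _, ⟨b, hb, rfl⟩, by simp [X, monomial_mul]⟩

theorem mem_edgeIdeal_pow_iff {σ K : Type*} [CommSemiring K] {G : SimpleGraph σ} {k : ℕ}
    {f : MvPolynomial σ K} :
    f ∈ Ideal.span {f : MvPolynomial σ K | ∃ i j, G.Adj i j ∧ f = X i * X j} ^ k ↔
      ∀ a ∈ f.support, HasEdgePacking G k a := by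
  rw [edgeIdeal_pow_eq_span_monomial, mem_ideal_span_monomial_image]
  refine forall₂_congr fun a _ => ⟨?_, fun h => ⟨a, h, le_rfl⟩⟩
  rintro ⟨b, hb, hba⟩
  obtain ⟨c, rfl⟩ := exists_add_of_le hba
  rw [add_comm]
  exact HasEdgePacking.add_left hb c

/-- The colon ideal `I ^ (k + 1) : I` of an edge ideal `I` is contained in `I ^ k`. -/
theorem mem_edgeIdeal_pow_of_forall_mul_mem {σ K : Type*} [CommSemiring K]
    {G : SimpleGraph σ} (hG : ∃ i j, G.Adj i j) {k : ℕ} {f : MvPolynomial σ K}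
    (h : ∀ i j, G.Adj i j → X i * X j * f ∈
      Ideal.span {f : MvPolynomial σ K | ∃ i j, G.Adj i j ∧ f = X i * X j} ^ (k + 1)) :
    f ∈ Ideal.span {f : MvPolynomial σ K | ∃ i j, G.Adj i j ∧ f = X i * X j} ^ k := by
  rw [mem_edgeIdeal_pow_iff]
  refine fun a ha => HasEdgePacking.of_forall_edge_add hG fun i j hij => ?_
  refine mem_edgeIdeal_pow_iff.1 (h i j hij) _ ?_
  rw [show (X i * X j : MvPolynomial σ K) = monomial (.single i 1 + .single j 1) 1 by
    simp [X, monomial_mul], mem_support_iff, coeff_monomial_mul, one_mul]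
  exact mem_support_iff.1 ha

theorem associatedPrimes_quotient_pow_subset_succ {R : Type*} [CommRing R] [IsNoetherianRing R]
    {I : Ideal R} {k : ℕ} (h : ∀ f, (∀ g ∈ I, g * f ∈ I ^ (k + 1)) → f ∈ I ^ k) :
    associatedPrimes R (R ⧸ I ^ k) ⊆ associatedPrimes R (R ⧸ I ^ (k + 1)) := by
  intro P hP
  obtain ⟨hprime, x, hx⟩ := isAssociatedPrime_iff.1 hP
  obtain ⟨c, rfl⟩ := Ideal.Quotient.mk_surjective x
  let N : Submodule R (R ⧸ I ^ (k + 1)) :=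
    I • Submodule.span R {(Ideal.Quotient.mk (I ^ (k + 1)) c)}
  have hPc (r : R) : r ∈ P ↔ r * c ∈ I ^ k := by
    rw [hx, Submodule.mem_colon_singleton, Submodule.mem_bot, ← Ideal.Quotient.eq_zero_iff_mem]
    rfl
  have hN : Module.annihilator R N = P := by
    ext r
    rw [Submodule.mem_annihilator, hPc]
    constructor
    · refine fun hr => h _ fun g hg => ?_
      rw [← Ideal.Quotient.eq_zero_iff_mem, mul_left_comm]
      exact hr _ (Submodule.smul_mem_smul hg (Submodule.mem_span_singleton_self _))
    · intro hr n hn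
      refine Submodule.smul_induction_on hn (fun g hg y hy => ?_) (fun y z hy hz => ?_)
      · obtain ⟨t, rfl⟩ := Submodule.mem_span_singleton.1 hy
        have : Ideal.Quotient.mk (I ^ (k + 1)) (r * (g * (t * c))) = 0 := by
          rw [Ideal.Quotient.eq_zero_iff_mem, show r * (g * (t * c)) = t * (r * c * g) by ring,
            pow_succ]
          exact Ideal.mul_mem_left _ _ (Ideal.mul_mem_mul hr hg)
        exact this
      · rw [smul_add, hy, hz, add_zero]
  apply associatedPrimes.subset_of_injective N.injective_subtype
  apply Module.associatedPrimes.minimalPrimes_annihilator_subset_associatedPrimes R N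
  rw [hN, Ideal.minimalPrimes_eq_subsingleton_self]
  rfl

/-- **persistence of edge ideals.** For the edge ideal `I = I(G)` of a
finite simple graph `G`, the associated primes of `S/I^k` are contained in the
associated primes of `S/I^{k+1}` for every `k ≥ 1`. -/
theorem edgeIdeal_persistence
    {s : ℕ} (K : Type*) [Field K] (G : SimpleGraph (Fin s))
    (I : Ideal (MvPolynomial (Fin s) K))
    (hI : I = Ideal.span {f : MvPolynomial (Fin s) K | ∃ i j : Fin s, G.Adj i j ∧ f = X i * X j}) :
    ∀ k : ℕ, 1 ≤ k →
      associatedPrimes (MvPolynomial (Fin s) K) (MvPolynomial (Fin s) K ⧸ I ^ k) ⊆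
        associatedPrimes (MvPolynomial (Fin s) K) (MvPolynomial (Fin s) K ⧸ I ^ (k + 1)) := by
  intro k hk
  by_cases hG : ∃ i j, G.Adj i j
  · refine associatedPrimes_quotient_pow_subset_succ fun f hf => ?_
    subst hI
    exact mem_edgeIdeal_pow_of_forall_mul_mem hG fun i j hij =>
      hf _ (Ideal.subset_span ⟨i, j, hij, rfl⟩)
  · have hI0 : I = 0 := by
      rw [hI, Ideal.zero_eq_bot, Ideal.span_eq_bot]
      rintro f ⟨i, j, hij, -⟩
      exact absurd ⟨i, j, hij⟩ hG
    rw [hI0, zero_pow (by omega), zero_pow k.succ_ne_zero]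
end

section
/- Let G be a finite simple graph on vertex set {t_1,…,t_s} with at least one edge and let I_c(G) ⊆ S = K[t_1,…,t_s] be its ideal of covers. Then the chromatic number of G equals the least positive integer k such that the monomial (t_1 t_2 ⋯ t_s)^{k-1} belongs to I_c(G)^k. -/
open MvPolynomial

/-- The monomial `∏ i ∈ C, X i` has exponent the indicator of `C`. -/
lemma prod_X_eq_monomial_sum_single {σ R : Type*} [CommSemiring R] (C : Finset σ) :
    (∏ i ∈ C, X i : MvPolynomial σ R) = monomial (∑ i ∈ C, Finsupp.single i 1) 1 := by
  rw [monomial_sum_one]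
  rfl

open scoped Pointwise in
/-- If a monomial lies in the `k`-th power of an ideal generated by squarefree monomials,
it is divisible by a product of `k` of these generators. -/
lemma exists_sum_indicator_le_of_monomial_mem_span_pow {σ R : Type*} [CommSemiring R]
    [Nontrivial R] (P : Finset σ → Prop) (k : ℕ) (m : σ →₀ ℕ)
    (hm : (monomial m 1 : MvPolynomial σ R) ∈
      Ideal.span {f : MvPolynomial σ R | ∃ C, P C ∧ f = ∏ i ∈ C, X i} ^ k) :
    ∃ C : Fin k → Finset σ, (∀ j, P (C j)) ∧
      ∑ j, ∑ i ∈ C j, Finsupp.single i 1 ≤ m := by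
  rw [Ideal.span, Submodule.span_pow] at hm
  have hsub : {f : MvPolynomial σ R | ∃ C, P C ∧ f = ∏ i ∈ C, X i} ^ k ⊆
      (fun e => monomial e (1 : R)) '' {e | ∃ C : Fin k → Finset σ, (∀ j, P (C j)) ∧
        e = ∑ j, ∑ i ∈ C j, Finsupp.single i 1} := by
    intro f hf
    obtain ⟨g, rfl⟩ := Set.mem_pow.1 hf
    choose C hC hg using fun j => (g j).2
    refine ⟨_, ⟨C, hC, rfl⟩, ?_⟩
    simp only [List.prod_ofFn, hg, prod_X_eq_monomial_sum_single, monomial_sum_one]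
  have hmem := mem_ideal_span_monomial_image.1 (Submodule.span_mono hsub hm) m <| by
    classical
    rw [mem_support_iff, coeff_monomial, if_pos rfl]
    exact one_ne_zero
  obtain ⟨_, ⟨C, hC, rfl⟩, hle⟩ := hmem
  exact ⟨C, hC, hle⟩

/-- For positive `k`, a graph is `k`-colorable if and only if `(t_1 ⋯ t_s)^{k-1}` lies in the
`k`-th power of its ideal of covers. -/
lemma colorable_iff_prod_X_pow_mem_coverIdeal_pow {σ : Type*} [Fintype σ] (R : Type*)
    [CommSemiring R] [Nontrivial R] (G : SimpleGraph σ) {k : ℕ} (hk : 1 ≤ k) :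
    G.Colorable k ↔ (∏ i, X i : MvPolynomial σ R) ^ (k - 1) ∈
      Ideal.span {f : MvPolynomial σ R | ∃ C : Finset σ,
        (∀ i j, G.Adj i j → i ∈ C ∨ j ∈ C) ∧ f = ∏ i ∈ C, X i} ^ k := by
  classical
  constructor
  · rintro ⟨c⟩
    have hprod : (∏ i, X i : MvPolynomial σ R) ^ (k - 1) =
        ∏ j : Fin k, ∏ i with c i ≠ j, X i := by
      simp_rw [Finset.prod_filter]
      rw [Finset.prod_comm, ← Finset.prod_pow]
      refine Finset.prod_congr rfl fun i _ => ?_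
      rw [← Finset.prod_filter, Finset.prod_const, Finset.filter_ne, Finset.card_erase_of_mem
        (Finset.mem_univ _), Finset.card_univ, Fintype.card_fin]
    rw [hprod]
    have hpow := Ideal.prod_mem_prod (s := Finset.univ)
      (I := fun _ : Fin k => Ideal.span {f : MvPolynomial σ R | ∃ C : Finset σ,
        (∀ i j, G.Adj i j → i ∈ C ∨ j ∈ C) ∧ f = ∏ i ∈ C, X i})
      (x := fun j : Fin k => ∏ i with c i ≠ j, X i) fun j _ =>
        Ideal.subset_span ⟨_, fun a b hab => ?_, rfl⟩
    · simpa using hpow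
    · simp only [Finset.mem_filter, Finset.mem_univ, true_and]
      by_contra! h
      exact c.valid hab (h.1.trans h.2.symm)
  · intro h
    rw [prod_X_eq_monomial_sum_single, monomial_pow, one_pow] at h
    obtain ⟨C, hC, hle⟩ := exists_sum_indicator_le_of_monomial_mem_span_pow _ k _ h
    have hex : ∀ v, ∃ j, v ∉ C j := by
      intro v
      by_contra! hv
      have hlev := hle v
      simp [Finsupp.finsetSum_apply, Finsupp.single_apply, hv] at hlev
      omega
    choose c hc using hex
    refine ⟨SimpleGraph.Coloring.mk c fun {a b} hab heq => ?_⟩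
    rcases hC (c a) a b hab with ha | hb
    · exact hc a ha
    · exact hc b (heq ▸ hb)

/-- **Francisco–Hà–Van Tuyl.** For a finite simple graph `G` with at
least one edge and ideal of covers `I_c(G)`, the chromatic number of `G` equals the
least positive integer `k` such that `(t_1 ⋯ t_s)^{k-1} ∈ I_c(G)^k`. -/
theorem chromaticNumber_eq_least_power_coverIdeal
    {s : ℕ} (K : Type*) [Field K] (G : SimpleGraph (Fin s))
    (hEdge : ∃ i j : Fin s, G.Adj i j)
    (Ic : Ideal (MvPolynomial (Fin s) K))
    (hIc : Ic = Ideal.span {f : MvPolynomial (Fin s) K |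
      ∃ C : Finset (Fin s), (∀ i j : Fin s, G.Adj i j → i ∈ C ∨ j ∈ C) ∧
        f = ∏ i ∈ C, X i}) :
    G.chromaticNumber =
      ((sInf {k : ℕ | 1 ≤ k ∧ (∏ i, X i : MvPolynomial (Fin s) K) ^ (k - 1) ∈ Ic ^ k} : ℕ) : ℕ∞) := by
  subst hIc
  obtain ⟨v, -, -⟩ := hEdge
  have hset : {k : ℕ | 1 ≤ k ∧ (∏ i, X i : MvPolynomial (Fin s) K) ^ (k - 1) ∈
      Ideal.span {f : MvPolynomial (Fin s) K | ∃ C : Finset (Fin s),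
        (∀ i j : Fin s, G.Adj i j → i ∈ C ∨ j ∈ C) ∧ f = ∏ i ∈ C, X i} ^ k} =
      {k | G.Colorable k} := by
    ext k
    refine ⟨fun h => (colorable_iff_prod_X_pow_mem_coverIdeal_pow K G h.1).2 h.2, fun h => ?_⟩
    have hk : 1 ≤ k := by
      obtain ⟨c⟩ := h
      exact (c v).pos
    exact ⟨hk, (colorable_iff_prod_X_pow_mem_coverIdeal_pow K G hk).1 h⟩
  rw [hset]
  exact G.colorable_of_fintype.chromaticNumber_eq_sInf
end

section
/- Let G be a finite bipartite simple graph without isolated vertices. Then G is well-covered (all maximal stable sets of G have the same cardinality) if and only if G has a bipartition of its vertex set into V_1 = {x_1,…,x_g} and V_2 = {y_1,…,y_g} such that: (a) {x_i,y_i} is an edge of G for all i = 1,…,g, and (b) whenever {x_i,y_j} and {x_j,y_k} are edges of G and i, j, k are distinct, {x_i,y_k} is an edge of G. -/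
/-- A set of vertices is stable (independent) in `G`. -/
def IsStableSet {V : Type*} (G : SimpleGraph V) (A : Set V) : Prop :=
  ∀ a ∈ A, ∀ b ∈ A, ¬ G.Adj a b

/-- A maximal stable set of `G`. -/
def IsMaximalStableSet {V : Type*} (G : SimpleGraph V) (A : Set V) : Prop :=
  IsStableSet G A ∧ ∀ B : Set V, IsStableSet G B → A ⊆ B → A = B

/-- If no cycle of `G` is odd, then the bypass of a walk has a length of the same parity. -/
lemma SimpleGraph.Walk.even_length_bypass_iff_s9 {V : Type*} [DecidableEq V] {G : SimpleGraph V}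
    (hG : ∀ (v : V) (w : G.Walk v v), w.IsCycle → ¬ Odd w.length) {u v : V} (p : G.Walk u v) :
    Even p.bypass.length ↔ Even p.length := by
  induction p with
  | nil => simp [SimpleGraph.Walk.bypass]
  | @cons u v w h p ih =>
    rw [SimpleGraph.Walk.bypass]
    split_ifs with hs
    · have hlen := congrArg SimpleGraph.Walk.length (p.bypass.take_spec hs)
      rw [SimpleGraph.Walk.length_append] at hlen
      have hodd : Odd (p.bypass.takeUntil u hs).length := by
        have hpath := p.bypass_isPath.takeUntil hs
        by_cases he : s(u, v) ∈ (p.bypass.takeUntil u hs).edges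
        · rw [hpath.length_eq_one_of_mem_edges (Sym2.eq_swap ▸ he)]
          exact odd_one
        · have := hG u _ ((SimpleGraph.Walk.cons_isCycle_iff _ h).2 ⟨hpath, he⟩)
          rw [SimpleGraph.Walk.length_cons] at this
          grind
      rw [SimpleGraph.Walk.length_cons]
      grind
    · simp only [SimpleGraph.Walk.length_cons]
      grind

lemma SimpleGraph.isBipartite_of_forall_isCycle {V : Type*} {G : SimpleGraph V}
    (hG : ∀ (v : V) (w : G.Walk v v), w.IsCycle → ¬ Odd w.length) : G.IsBipartite := by
  classical
  refine SimpleGraph.two_colorable_iff_forall_loop_even.2 fun u w ↦ ?_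
  rw [← w.even_length_bypass_iff_s9 hG,
    SimpleGraph.Walk.length_eq_zero_iff.2 (SimpleGraph.Walk.isPath_iff_nil.1 w.bypass_isPath)]
  exact Even.zero

lemma IsStableSet.exists_isMaximalStableSet_superset {V : Type*} [Finite V] {G : SimpleGraph V}
    {A : Set V} (hA : IsStableSet G A) : ∃ B, A ⊆ B ∧ IsMaximalStableSet G B := by
  obtain ⟨B, hAB, hB⟩ := Finite.exists_le_maximal hA
  exact ⟨B, hAB, hB.prop, fun C hC hBC ↦ hB.eq_of_le hC hBC⟩

lemma IsMaximalStableSet.exists_adj_of_notMem {V : Type*} {G : SimpleGraph V} {B : Set V}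
    (hB : IsMaximalStableSet G B) {v : V} (hv : v ∉ B) : ∃ u ∈ B, G.Adj v u := by
  by_contra! h
  refine hv ?_
  rw [hB.2 (insert v B) ?_ (Set.subset_insert _ _)]
  · exact Set.mem_insert _ _
  · rintro a (rfl | ha) b (rfl | hb)
    · exact G.irrefl
    · exact h b hb
    · exact fun hab ↦ h a ha hab.symm
    · exact hB.1 a ha b hb

/-- A stable set meets every edge of a perfect matching at most once, so its size is the number
of matching edges that it meets. -/
lemma IsStableSet.ncard_eq_ncard_setOf_mem_or_mem {V ι : Type*} {G : SimpleGraph V} {B : Set V}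
    (hB : IsStableSet G B) {x y : ι → V} (hx : Function.Injective x) (hy : Function.Injective y)
    (hxy : ∀ i j, x i ≠ y j) (hcov : ∀ v, (∃ i, v = x i) ∨ (∃ i, v = y i))
    (hadj : ∀ i, G.Adj (x i) (y i)) :
    B.ncard = {i | x i ∈ B ∨ y i ∈ B}.ncard := by
  classical
  symm
  refine Set.ncard_congr (fun i _ ↦ if x i ∈ B then x i else y i) ?_ ?_ ?_
  · grind
  · intro i j _ _ hij
    split_ifs at hij
    · exact hx hij
    · exact (hxy _ _ hij).elim
    · exact (hxy _ _ hij.symm).elim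
    · exact hy hij
  · intro v hv
    rcases hcov v with ⟨i, rfl⟩ | ⟨i, rfl⟩
    · exact ⟨i, Or.inl hv, if_pos hv⟩
    · exact ⟨i, Or.inr hv, if_neg fun h ↦ hB _ h _ hv (hadj i)⟩

/-- A maximal stable set meets every edge of a perfect matching satisfying the exchange
condition. -/
lemma IsMaximalStableSet.mem_or_mem_of_matching {V ι : Type*} {G : SimpleGraph V} {B : Set V}
    (hB : IsMaximalStableSet G B) {x y : ι → V}
    (hcov : ∀ v, (∃ i, v = x i) ∨ (∃ i, v = y i))
    (hxx : ∀ i j, ¬ G.Adj (x i) (x j)) (hyy : ∀ i j, ¬ G.Adj (y i) (y j))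
    (hadj : ∀ i, G.Adj (x i) (y i))
    (hexch : ∀ i j k, i ≠ j → j ≠ k → i ≠ k →
      G.Adj (x i) (y j) → G.Adj (x j) (y k) → G.Adj (x i) (y k)) (j : ι) :
    x j ∈ B ∨ y j ∈ B := by
  by_contra! hj
  obtain ⟨u, hu, hju⟩ := hB.exists_adj_of_notMem hj.1
  obtain ⟨v, hv, hjv⟩ := hB.exists_adj_of_notMem hj.2
  obtain ⟨k, rfl⟩ := (hcov u).resolve_left (by rintro ⟨k, rfl⟩; exact hxx _ _ hju)
  obtain ⟨i, rfl⟩ := (hcov v).resolve_right (by rintro ⟨i, rfl⟩; exact hyy _ _ hjv)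
  have hik : ¬ G.Adj (x i) (y k) := hB.1 _ hv _ hu
  exact hik (hexch i j k (by grind) (by grind) (by grind) hjv.symm hju)

/-- A colour class of a two-colouring of a graph without isolated vertices is a maximal
stable set. -/
lemma SimpleGraph.Coloring.isMaximalStableSet_colorClass {V : Type*} {G : SimpleGraph V}
    (C : G.Coloring (Fin 2)) (hiso : ∀ v, ∃ u, G.Adj v u) (c : Fin 2) :
    IsMaximalStableSet G (C.colorClass c) := by
  refine ⟨fun a ha b hb hab ↦ C.valid hab (Eq.trans ha (Eq.symm hb)), fun B hB hCB ↦ ?_⟩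
  refine hCB.antisymm fun v hv ↦ ?_
  obtain ⟨u, hu⟩ := hiso v
  by_contra hvc
  have hne := C.valid hu
  have hvc : C v ≠ c := hvc
  exact hB v hv u (hCB (show C u = c by grind)) hu

/-- In a well-covered graph, Hall's condition holds from a stable set towards any maximal stable
set disjoint from it. -/
lemma ncard_le_ncard_neighbors_of_wellCovered {V : Type*} [Finite V] {G : SimpleGraph V}
    (hG : ∀ A B : Set V, IsMaximalStableSet G A → IsMaximalStableSet G B → A.ncard = B.ncard)
    {X Y A : Set V} (hXY : Disjoint X Y) (hX : IsStableSet G X) (hY : IsMaximalStableSet G Y)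
    (hA : A ⊆ X) : A.ncard ≤ {b ∈ Y | ∃ a ∈ A, G.Adj a b}.ncard := by
  set N := {b ∈ Y | ∃ a ∈ A, G.Adj a b}
  have hstable : IsStableSet G (A ∪ (Y \ N)) := by
    rintro a (ha | ha) b (hb | hb) hab
    · exact hX a (hA ha) b (hA hb) hab
    · exact hb.2 ⟨hb.1, a, ha, hab⟩
    · exact ha.2 ⟨ha.1, b, hb, hab.symm⟩
    · exact hY.1 a ha.1 b hb.1 hab
  obtain ⟨B, hsub, hB⟩ := hstable.exists_isMaximalStableSet_superset
  have hle := Set.ncard_le_ncard hsub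
  rw [hG B Y hB hY, Set.ncard_union_eq (hXY.mono hA Set.sdiff_subset)] at hle
  have hN := Set.ncard_sdiff_add_ncard_of_subset (show N ⊆ Y from fun _ h ↦ h.1)
  lia

/-- Two disjoint maximal stable sets of a well-covered graph are perfectly matched to each other. -/
lemma exists_equiv_adj_of_wellCovered {V : Type*} [Finite V] {G : SimpleGraph V}
    (hG : ∀ A B : Set V, IsMaximalStableSet G A → IsMaximalStableSet G B → A.ncard = B.ncard)
    {X Y : Set V} (hXY : Disjoint X Y) (hX : IsMaximalStableSet G X)
    (hY : IsMaximalStableSet G Y) : ∃ f : X ≃ Y, ∀ a : X, G.Adj a (f a) := by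
  classical
  have := Fintype.ofFinite V
  obtain ⟨f, hf, hadj⟩ := (Fintype.all_card_le_filter_rel_iff_exists_injective
    (fun (a : X) (b : Y) ↦ G.Adj a b)).1 fun A ↦ by
      have h := ncard_le_ncard_neighbors_of_wellCovered hG hXY hX.1 hY
        (A := (↑) '' (A : Set X)) (by simp)
      rw [Set.ncard_image_of_injective _ Subtype.val_injective, Set.ncard_coe_finset] at h
      refine h.trans_eq ?_
      rw [← Set.ncard_coe_finset, ← Set.ncard_image_of_injective _ Subtype.val_injective]
      congr 1
      ext b
      simp [and_comm]
  have hcard : Fintype.card X = Fintype.card Y := by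
    simpa [← Nat.card_eq_fintype_card] using hG X Y hX hY
  exact ⟨Equiv.ofBijective f ((Fintype.bijective_iff_injective_and_card f).2 ⟨hf, hcard⟩), hadj⟩

/-- A perfect matching of a bipartite well-covered graph satisfies the exchange condition. -/
lemma adj_of_adj_of_adj_of_wellCovered {V ι : Type*} [Finite V] [Finite ι] {G : SimpleGraph V}
    (hG : ∀ A B : Set V, IsMaximalStableSet G A → IsMaximalStableSet G B → A.ncard = B.ncard)
    {x y : ι → V} (hx : Function.Injective x) (hy : Function.Injective y)
    (hxy : ∀ i j, x i ≠ y j) (hcov : ∀ v, (∃ i, v = x i) ∨ (∃ i, v = y i))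
    (hadj : ∀ i, G.Adj (x i) (y i)) (hmax : IsMaximalStableSet G (Set.range x)) {i j k : ι}
    (hij : G.Adj (x i) (y j)) (hjk : G.Adj (x j) (y k)) : G.Adj (x i) (y k) := by
  by_contra hik
  have hstable : IsStableSet G {x i, y k} := by
    rintro a (rfl | rfl) b (rfl | rfl)
    · exact G.irrefl
    · exact hik
    · exact fun h ↦ hik h.symm
    · exact G.irrefl
  obtain ⟨B, hsub, hB⟩ := hstable.exists_isMaximalStableSet_superset
  have hcard := hG B _ hB hmax
  rw [hB.1.ncard_eq_ncard_setOf_mem_or_mem hx hy hxy hcov hadj, ← Set.image_univ,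
    Set.ncard_image_of_injective _ hx] at hcard
  have huniv := Set.eq_of_subset_of_ncard_le (Set.subset_univ _) hcard.ge
  rcases (huniv ▸ Set.mem_univ j : j ∈ {i | x i ∈ B ∨ y i ∈ B}) with h | h
  · exact hB.1 _ h _ (hsub (by simp)) hjk
  · exact hB.1 _ (hsub (by simp)) _ h hij

/-- A bipartite graph `G` without isolated vertices is well-covered
(all maximal stable sets have the same cardinality) iff `G` admits a bipartition
`V₁ = {x_1,…,x_g}`, `V₂ = {y_1,…,y_g}` such that (a) `{x_i, y_i}` is an edge for every
`i`, and (b) if `{x_i,y_j}` and `{x_j,y_k}` are edges and `i, j, k` are distinct, then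
`{x_i,y_k}` is an edge. -/
theorem bipartite_wellCovered_iff
    {V : Type*} [Fintype V] (G : SimpleGraph V)
    (hbip : ∀ (v : V) (w : G.Walk v v), w.IsCycle → ¬ Odd w.length)
    (hiso : ∀ v : V, ∃ u : V, G.Adj v u) :
    (∀ A B : Set V, IsMaximalStableSet G A → IsMaximalStableSet G B → A.ncard = B.ncard) ↔
      ∃ (g : ℕ) (x y : Fin g → V),
        -- V₁ = {x_1,…,x_g} and V₂ = {y_1,…,y_g} form a bipartition of G:
        (∀ i j, x i = x j → i = j) ∧ (∀ i j, y i = y j → i = j) ∧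
        (∀ i j, x i ≠ y j) ∧
        (∀ v : V, (∃ i, v = x i) ∨ (∃ i, v = y i)) ∧
        (∀ i j, ¬ G.Adj (x i) (x j)) ∧ (∀ i j, ¬ G.Adj (y i) (y j)) ∧
        -- (a)
        (∀ i, G.Adj (x i) (y i)) ∧
        -- (b)
        (∀ i j k, i ≠ j → j ≠ k → i ≠ k →
          G.Adj (x i) (y j) → G.Adj (x j) (y k) → G.Adj (x i) (y k)) := by
  constructor
  · intro hG
    obtain ⟨C⟩ := SimpleGraph.isBipartite_of_forall_isCycle hbip
    have hX := C.isMaximalStableSet_colorClass hiso 0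
    have hY := C.isMaximalStableSet_colorClass hiso 1
    have hXY : Disjoint (C.colorClass 0) (C.colorClass 1) :=
      Set.disjoint_left.2 fun v (h₀ : C v = 0) (h₁ : C v = 1) ↦ by simp [h₀] at h₁
    obtain ⟨f, hf⟩ := exists_equiv_adj_of_wellCovered hG hXY hX hY
    let e := (Finite.equivFin (C.colorClass 0)).symm
    have hx : Function.Injective fun i ↦ (e i : V) := Subtype.val_injective.comp e.injective
    have hy : Function.Injective fun i ↦ (f (e i) : V) :=
      Subtype.val_injective.comp (f.injective.comp e.injective)
    have hxy : ∀ i j, (e i : V) ≠ f (e j) := fun i j ↦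
      hXY.ne_of_mem (e i).2 (f (e j)).2
    have hcov : ∀ v : V, (∃ i, v = e i) ∨ (∃ i, v = f (e i)) := by
      intro v
      rcases (by lia : C v = 0 ∨ C v = 1) with hv | hv
      · exact Or.inl ⟨e.symm ⟨v, hv⟩, by rw [e.apply_symm_apply]⟩
      · exact Or.inr ⟨e.symm (f.symm ⟨v, hv⟩), by rw [e.apply_symm_apply, f.apply_symm_apply]⟩
    have hrange : Set.range (fun i ↦ (e i : V)) = C.colorClass 0 := by
      rw [Set.range_comp' Subtype.val, e.surjective.range_eq, Subtype.coe_image_univ]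
    exact ⟨_, fun i ↦ e i, fun i ↦ f (e i), fun _ _ h ↦ hx h, fun _ _ h ↦ hy h, hxy, hcov,
      fun i j ↦ hX.1 _ (e i).2 _ (e j).2, fun i j ↦ hY.1 _ (f (e i)).2 _ (f (e j)).2,
      fun i ↦ hf _, fun i j k _ _ _ hij hjk ↦ adj_of_adj_of_adj_of_wellCovered hG hx hy hxy hcov
        (fun i ↦ hf _) (hrange.symm ▸ hX) hij hjk⟩
  · rintro ⟨g, x, y, hx, hy, hxy, hcov, hxx, hyy, hadj, hexch⟩
    have hcard : ∀ B : Set V, IsMaximalStableSet G B → B.ncard = g := by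
      intro B hB
      have huniv : {i | x i ∈ B ∨ y i ∈ B} = Set.univ :=
        Set.eq_univ_of_forall (hB.mem_or_mem_of_matching hcov hxx hyy hadj hexch)
      rw [hB.1.ncard_eq_ncard_setOf_mem_or_mem hx hy hxy hcov hadj, huniv, Set.ncard_univ,
        Nat.card_fin]
    intro A B hA hB
    rw [hcard A hA, hcard B hB]
end

section
/- Let I ⊆ S = K[t_1,…,t_s] be a monomial ideal minimally generated by monomials t^{v_1},…,t^{v_m}, let A be the s×m matrix with columns v_1,…,v_m, let α ∈ ℕ^s and let n ≥ 1 be an integer. Then there exists an integer p ≥ 1 with (t^α)^p ∈ I^{pn} (i.e., t^α lies in the integral closure of I^n) if and only if there exists λ ∈ ℚ^m with λ ≥ 0, Aλ ≤ α componentwise, and λ_1 + ⋯ + λ_m ≥ n. -/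
open MvPolynomial

/-- The `N`-th power of a finitely generated ideal is spanned by the products of the generators
of total degree `N`. -/
theorem Ideal.span_range_pow_eq_span_prod_pow {R ι : Type*} [CommSemiring R] [Fintype ι]
    (g : ι → R) (N : ℕ) :
    Ideal.span (Set.range g) ^ N =
      Ideal.span {f | ∃ k : ι → ℕ, ∑ j, k j = N ∧ f = ∏ j, g j ^ k j} := by
  classical
  apply le_antisymm
  · induction N with
    | zero =>
      rw [pow_zero, Ideal.one_eq_top, top_le_iff, Ideal.eq_top_iff_one]
      exact Ideal.subset_span ⟨0, by simp, by simp⟩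
    | succ N ih =>
      rw [pow_succ]
      refine (Ideal.mul_mono_left ih).trans ?_
      rw [Ideal.span_mul_span', Ideal.span_le]
      rintro _ ⟨_, ⟨k, hk, rfl⟩, _, ⟨j, rfl⟩, rfl⟩
      refine Ideal.subset_span ⟨k + Pi.single j 1, ?_, ?_⟩
      · simp [Finset.sum_add_distrib, hk]
      · simp_rw [Pi.add_apply, pow_add]
        rw [Finset.prod_mul_distrib]
        simp [Pi.single_apply, pow_ite]
  · rw [Ideal.span_le]
    rintro _ ⟨k, rfl, rfl⟩
    rw [← Finset.prod_pow_eq_pow_sum]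
    exact Ideal.prod_mem_prod fun j _ =>
      Ideal.pow_mem_pow (Ideal.subset_span (Set.mem_range_self j)) _

theorem MvPolynomial.prod_X_pow_eq_monomial_equivFunOnFinite {σ R : Type*} [Fintype σ]
    [CommSemiring R] (a : σ → ℕ) :
    (∏ i, X i ^ a i : MvPolynomial σ R) = monomial (Finsupp.equivFunOnFinite.symm a) 1 := by
  rw [← MvPolynomial.prod_X_pow_eq_monomial]
  exact (Finset.prod_subset (Finset.subset_univ _) fun i _ hi => by
    have h : a i = 0 := by simpa using hi
    simp [h]).symm

/-- A monomial lies in the `N`-th power of a monomial ideal iff it is divisible by a product of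
`N` generators. -/
theorem MvPolynomial.prod_X_pow_mem_span_range_pow_iff {σ ι R : Type*} [Fintype σ] [Fintype ι]
    [CommSemiring R] [Nontrivial R] (v : ι → σ → ℕ) (a : σ → ℕ) (N : ℕ) :
    (∏ i, X i ^ a i : MvPolynomial σ R) ∈
        Ideal.span (Set.range fun j => (∏ i, X i ^ v j i : MvPolynomial σ R)) ^ N ↔
      ∃ k : ι → ℕ, ∑ j, k j = N ∧ ∀ i, ∑ j, k j * v j i ≤ a i := by
  have hset : {f : MvPolynomial σ R | ∃ k : ι → ℕ, ∑ j, k j = N ∧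
        f = ∏ j, (∏ i, X i ^ v j i : MvPolynomial σ R) ^ k j} =
      (fun d => monomial d (1 : R)) ''
        {d | ∃ k : ι → ℕ, ∑ j, k j = N ∧
          d = Finsupp.equivFunOnFinite.symm fun i => ∑ j, k j * v j i} := by
    have hprod (k : ι → ℕ) : ∏ j, (∏ i, X i ^ v j i : MvPolynomial σ R) ^ k j =
        monomial (Finsupp.equivFunOnFinite.symm fun i => ∑ j, k j * v j i) 1 := by
      rw [← prod_X_pow_eq_monomial_equivFunOnFinite]
      simp_rw [← Finset.prod_pow, ← pow_mul, ← Finset.prod_pow_eq_pow_sum]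
      rw [Finset.prod_comm]
      simp_rw [mul_comm]
    ext f
    constructor
    · rintro ⟨k, hk, rfl⟩
      exact ⟨_, ⟨k, hk, rfl⟩, (hprod k).symm⟩
    · rintro ⟨_, ⟨k, hk, rfl⟩, rfl⟩
      exact ⟨k, hk, (hprod k).symm⟩
  rw [Ideal.span_range_pow_eq_span_prod_pow, hset, mem_ideal_span_monomial_image,
    prod_X_pow_eq_monomial_equivFunOnFinite]
  classical
  simp only [support_monomial, one_ne_zero, if_false, Finset.mem_singleton, forall_eq]
  constructor
  · rintro ⟨_, ⟨k, hk, rfl⟩, h⟩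
    exact ⟨k, hk, fun i => by simpa using h i⟩
  · rintro ⟨k, hk, h⟩
    exact ⟨_, ⟨k, hk, rfl⟩, fun i => by simpa using h i⟩

/-- Finitely many nonnegative rationals have a common denominator. -/
theorem Rat.exists_common_denominator_of_nonneg {ι : Type*} [Fintype ι] (q : ι → ℚ)
    (hq : ∀ j, 0 ≤ q j) : ∃ p : ℕ, 1 ≤ p ∧ ∃ k : ι → ℕ, ∀ j, (k j : ℚ) = p * q j := by
  refine ⟨∏ j, (q j).den, Finset.prod_pos fun j _ => (q j).den_pos, ?_⟩
  choose c hc using fun j => Finset.dvd_prod_of_mem (fun j => (q j).den) (Finset.mem_univ j)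
  refine ⟨fun j => (q j).num.toNat * c j, fun j => ?_⟩
  have hnum : (((q j).num.toNat : ℕ) : ℚ) = (q j).num := by
    exact_mod_cast Int.toNat_of_nonneg (Rat.num_nonneg.mpr (hq j))
  rw [hc j]
  push_cast
  rw [hnum, ← Rat.mul_den_eq_num (q j)]
  ring

/-- **LP membership test.** Let `I ⊆ K[t_1,…,t_s]` be a monomial ideal
minimally generated by `t^{v_1},…,t^{v_m}`, let `α ∈ ℕ^s` and `n ≥ 1`.  Then `t^α` lies
in the integral closure of `I^n` (i.e. `(t^α)^p ∈ I^{pn}` for some `p ≥ 1`) iff there is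
`λ ∈ ℚ^m` with `λ ≥ 0`, `Aλ ≤ α` componentwise and `λ_1 + ⋯ + λ_m ≥ n`, where `A` is the
incidence matrix with columns `v_1,…,v_m`. -/
theorem monomial_mem_integralClosure_iff_lp
    {s m : ℕ} (K : Type*) [Field K]
    (v : Fin m → Fin s → ℕ)
    (I : Ideal (MvPolynomial (Fin s) K))
    (hgen : I = Ideal.span {f : MvPolynomial (Fin s) K | ∃ j : Fin m, f = ∏ i, X i ^ v j i})
    (hmin : ∀ j : Fin m, (∏ i, X i ^ v j i : MvPolynomial (Fin s) K) ∉
      Ideal.span {f : MvPolynomial (Fin s) K | ∃ k : Fin m, k ≠ j ∧ f = ∏ i, X i ^ v k i})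
    (α : Fin s → ℕ) (n : ℕ) (hn : 1 ≤ n) :
    (∃ p : ℕ, 1 ≤ p ∧ (∏ i, X i ^ α i : MvPolynomial (Fin s) K) ^ p ∈ I ^ (p * n)) ↔
      (∃ lam : Fin m → ℚ, (∀ j, 0 ≤ lam j) ∧
        (∀ i : Fin s, ∑ j, (v j i : ℚ) * lam j ≤ (α i : ℚ)) ∧
        (n : ℚ) ≤ ∑ j, lam j) := by
  have hI : I = Ideal.span
      (Set.range fun j => (∏ i, X i ^ v j i : MvPolynomial (Fin s) K)) := by
    rw [hgen]
    congr 1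
    ext f
    simp [eq_comm]
  have hpow (p : ℕ) : (∏ i, X i ^ α i : MvPolynomial (Fin s) K) ^ p =
      ∏ i, X i ^ (p * α i) := by
    simp_rw [← Finset.prod_pow, ← pow_mul, mul_comm]
  simp_rw [hpow, hI]
  constructor
  · rintro ⟨p, hp, h⟩
    obtain ⟨k, hk, hle⟩ := (prod_X_pow_mem_span_range_pow_iff v _ _).mp h
    have hp0 : (0 : ℚ) < p := by exact_mod_cast hp
    refine ⟨fun j => k j / p, fun j => by positivity, fun i => ?_, ?_⟩
    · simp_rw [← mul_div_assoc]
      rw [← Finset.sum_div, div_le_iff₀ hp0, mul_comm (α i : ℚ)]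
      simp_rw [mul_comm (v _ i : ℚ)]
      exact_mod_cast hle i
    · rw [← Finset.sum_div, le_div_iff₀ hp0, mul_comm]
      exact_mod_cast hk.ge
  · rintro ⟨lam, hnonneg, hle, hsum⟩
    obtain ⟨p, hp, k, hk⟩ := Rat.exists_common_denominator_of_nonneg lam hnonneg
    refine ⟨p, hp, Ideal.pow_le_pow_right (n := ∑ j, k j) ?_
      ((prod_X_pow_mem_span_range_pow_iff v _ _).mpr ⟨k, rfl, fun i => ?_⟩)⟩
    · have h : (p : ℚ) * n ≤ ∑ j, (k j : ℚ) := by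
        simp_rw [hk, ← Finset.mul_sum]
        gcongr
      exact_mod_cast h
    · have h : ∑ j, (k j : ℚ) * v j i ≤ p * α i := by
        calc ∑ j, (k j : ℚ) * v j i = p * ∑ j, (v j i : ℚ) * lam j := by
              rw [Finset.mul_sum]
              exact Finset.sum_congr rfl fun j _ => by rw [hk]; ring
          _ ≤ p * α i := by gcongr; exact hle i
      exact_mod_cast h
end

section
/- Let I ⊆ S = K[t_1,…,t_s] be an ideal generated by monomials t^{v_1},…,t^{v_m} all of the same total degree d. If the Rees algebra S[Iz] ⊆ S[z] is normal (integrally closed in its field of fractions), then the monomial subring K[t^{v_1},…,t^{v_m}] ⊆ S is normal (integrally closed in its field of fractions). -/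
open MvPolynomial

/-- A domain is integrally closed if it embeds into an integrally closed domain in such a way that
divisibility in the larger domain descends to the smaller one. -/
theorem IsIntegrallyClosed.of_injective_of_dvd_descends {A B : Type*} [CommRing A] [IsDomain A]
    [CommRing B] [IsDomain B] [IsIntegrallyClosed B] (f : A →+* B) (hf : Function.Injective f)
    (hdvd : ∀ a b : A, f b ∣ f a → b ∣ a) : IsIntegrallyClosed A := by
  rw [isIntegrallyClosed_iff (FractionRing A)]
  intro x hx
  let F : FractionRing A →+* FractionRing B := IsFractionRing.map hf
  have hF : ∀ a : A, F (algebraMap A _ a) = algebraMap B _ (f a) := fun a =>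
    IsLocalization.map_eq _ a
  have hFx : IsIntegral B (F x) := hx.map_of_comp_eq f F (RingHom.ext fun a => (hF a).symm)
  obtain ⟨r, hr⟩ := IsIntegrallyClosed.isIntegral_iff.mp hFx
  obtain ⟨a, b, hb, rfl⟩ := IsFractionRing.div_surjective (A := A) x
  have hb0 : algebraMap A (FractionRing A) b ≠ 0 :=
    IsFractionRing.to_map_ne_zero_of_mem_nonZeroDivisors hb
  have hdiv : f b ∣ f a := by
    refine ⟨r, IsFractionRing.injective B (FractionRing B) ?_⟩
    rw [map_mul, hr, ← hF, ← hF, ← map_mul, mul_div_cancel₀ _ hb0]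
  obtain ⟨c, rfl⟩ := hdvd a b hdiv
  exact ⟨c, by rw [map_mul, mul_div_cancel_left₀ _ hb0]⟩

namespace MvPolynomial

variable {σ R : Type*} [CommRing R]

section

attribute [local instance] MvPolynomial.gradedAlgebra

theorem homogeneousComponent_add_mul_of_isHomogeneous {m : ℕ} {w : MvPolynomial σ R}
    (hw : w.IsHomogeneous m) (n : ℕ) (p : MvPolynomial σ R) :
    homogeneousComponent (m + n) (w * p) = w * homogeneousComponent n p := by
  have h := DirectSum.coe_decompose_mul_add_of_left_mem (homogeneousSubmodule σ R) (i := m)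
    (j := n) (b := p) hw
  have key : ∀ (q : MvPolynomial σ R) (i : ℕ),
      (DirectSum.decompose (homogeneousSubmodule σ R) q i : MvPolynomial σ R) =
        homogeneousComponent i q := decomposition.decompose'_apply
  rwa [key, key] at h

end

/-- The part of a polynomial in `z` over `R[t]` spanned by the monomials `t ^ a * z ^ k` with
`|a| = d * k`. -/
noncomputable def diagonalPart (d : ℕ) (r : Polynomial (MvPolynomial σ R)) :
    Polynomial (MvPolynomial σ R) :=
  ∑ k ∈ r.support, Polynomial.monomial k (homogeneousComponent (d * k) (r.coeff k))

theorem coeff_diagonalPart (d : ℕ) (r : Polynomial (MvPolynomial σ R)) (k : ℕ) :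
    (diagonalPart d r).coeff k = homogeneousComponent (d * k) (r.coeff k) := by
  classical
  rw [diagonalPart, Polynomial.finsetSum_coeff]
  simp only [Polynomial.coeff_monomial, Finset.sum_ite_eq']
  split_ifs with h
  · rfl
  · rw [Polynomial.notMem_support_iff.mp h, map_zero]

theorem diagonalPart_add (d : ℕ) (r r' : Polynomial (MvPolynomial σ R)) :
    diagonalPart d (r + r') = diagonalPart d r + diagonalPart d r' := by
  ext1 k
  simp only [coeff_diagonalPart, Polynomial.coeff_add, map_add]

theorem diagonalPart_C (d : ℕ) (p : MvPolynomial σ R) :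
    diagonalPart d (Polynomial.C p) = Polynomial.C (C (coeff 0 p)) := by
  ext1 k
  rcases k with _ | k
  · simp [coeff_diagonalPart]
  · simp [coeff_diagonalPart, Polynomial.coeff_C_succ]

theorem diagonalPart_C_mul_X_mul {d : ℕ} {w : MvPolynomial σ R} (hw : w.IsHomogeneous d)
    (r : Polynomial (MvPolynomial σ R)) :
    diagonalPart d (Polynomial.C w * Polynomial.X * r) =
      Polynomial.C w * Polynomial.X * diagonalPart d r := by
  ext1 k
  rw [coeff_diagonalPart, mul_assoc, mul_assoc, Polynomial.coeff_C_mul, Polynomial.coeff_C_mul]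
  rcases k with _ | k
  · simp
  · rw [Polynomial.coeff_X_mul, Polynomial.coeff_X_mul, coeff_diagonalPart, mul_add, mul_one,
      add_comm, homogeneousComponent_add_mul_of_isHomogeneous hw]

/-- The set `{w * z | w ∈ W}` in `R[t][z]`. -/
def degreeOneGenerators (W : Set (MvPolynomial σ R)) : Set (Polynomial (MvPolynomial σ R)) :=
  (fun w => Polynomial.C w * Polynomial.X) '' W

theorem diagonalPart_mul_of_mem_adjoin {d : ℕ} {W : Set (MvPolynomial σ R)}
    (hW : ∀ w ∈ W, w.IsHomogeneous d) {a : Polynomial (MvPolynomial σ R)}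
    (ha : a ∈ Algebra.adjoin R (degreeOneGenerators W)) (r : Polynomial (MvPolynomial σ R)) :
    diagonalPart d (a * r) = a * diagonalPart d r := by
  induction ha using Algebra.adjoin_induction generalizing r with
  | mem x hx =>
    obtain ⟨w, hw, rfl⟩ := hx
    exact diagonalPart_C_mul_X_mul (hW w hw) r
  | algebraMap c =>
    ext1 k
    simp only [← Algebra.smul_def, coeff_diagonalPart, Polynomial.coeff_smul, map_smul]
  | add x y _ _ hx hy => rw [add_mul, add_mul, diagonalPart_add, hx, hy]
  | mul x y _ _ hx hy => rw [mul_assoc, mul_assoc, hx, hy]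

theorem diagonalPart_of_mem_adjoin {d : ℕ} {W : Set (MvPolynomial σ R)}
    (hW : ∀ w ∈ W, w.IsHomogeneous d) {a : Polynomial (MvPolynomial σ R)}
    (ha : a ∈ Algebra.adjoin R (degreeOneGenerators W)) : diagonalPart d a = a := by
  have h := diagonalPart_mul_of_mem_adjoin hW ha (Polynomial.C 1)
  rwa [diagonalPart_C, coeff_zero_one, C_1, Polynomial.C_1, mul_one] at h

theorem diagonalPart_mem_adjoin {d : ℕ} {W : Set (MvPolynomial σ R)}
    (hW : ∀ w ∈ W, w.IsHomogeneous d) {r : Polynomial (MvPolynomial σ R)}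
    (hr : r ∈ Algebra.adjoin (MvPolynomial σ R) (degreeOneGenerators W)) :
    diagonalPart d r ∈ Algebra.adjoin R (degreeOneGenerators W) := by
  rw [← Subalgebra.mem_toSubmodule, Algebra.adjoin_eq_span] at hr
  induction hr using Submodule.closure_induction with
  | zero =>
    rw [← Polynomial.C_0, diagonalPart_C]
    simp
  | add x y _ _ hx hy =>
    rw [diagonalPart_add]
    exact add_mem hx hy
  | smul_mem p g hg =>
    have hg' : g ∈ Algebra.adjoin R (degreeOneGenerators W) :=
      (Submonoid.closure_le (S := (Algebra.adjoin R _).toSubmonoid)).mpr Algebra.subset_adjoin hg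
    rw [Polynomial.smul_eq_C_mul, mul_comm, diagonalPart_mul_of_mem_adjoin hW hg', diagonalPart_C]
    exact mul_mem hg' (Subalgebra.algebraMap_mem _ (coeff 0 p))

theorem C_mul_X_mem_adjoin_of_mem_span {W : Set (MvPolynomial σ R)} {f : MvPolynomial σ R}
    (hf : f ∈ Ideal.span W) :
    Polynomial.C f * Polynomial.X ∈
      Algebra.adjoin (MvPolynomial σ R) (degreeOneGenerators W) := by
  induction hf using Submodule.span_induction with
  | mem w hw => exact Algebra.subset_adjoin ⟨w, hw, rfl⟩
  | zero => simp
  | add x y _ _ hx hy =>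
    rw [map_add, add_mul]
    exact add_mem hx hy
  | smul p x _ hx =>
    rw [smul_eq_mul, map_mul, mul_assoc, ← Polynomial.smul_eq_C_mul]
    exact Subalgebra.smul_mem _ hx p

/-- Evaluation of polynomials in `z` over `R[t]` at `z = 1`. -/
noncomputable def evalOne (σ R : Type*) [CommRing R] :
    Polynomial (MvPolynomial σ R) →ₐ[R] MvPolynomial σ R :=
  (Polynomial.aeval (1 : MvPolynomial σ R)).restrictScalars R

theorem map_evalOne_adjoin (W : Set (MvPolynomial σ R)) :
    (Algebra.adjoin R (degreeOneGenerators W)).map (evalOne σ R) = Algebra.adjoin R W := by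
  rw [AlgHom.map_adjoin, degreeOneGenerators, Set.image_image]
  simp [evalOne]

theorem evalOne_comp_val_injective {d : ℕ} (hd : d ≠ 0) {W : Set (MvPolynomial σ R)}
    (hW : ∀ w ∈ W, w.IsHomogeneous d) :
    Function.Injective
      ((evalOne σ R).comp (Algebra.adjoin R (degreeOneGenerators W)).val) := by
  rw [injective_iff_map_eq_zero]
  rintro ⟨a, ha⟩ h0
  have hsum : ∑ k ∈ a.support, a.coeff k = 0 := by
    simpa [evalOne, Polynomial.eval_eq_sum, Polynomial.sum_def] using h0
  have hcoeff : ∀ k, (a.coeff k).IsHomogeneous (d * k) := fun k => by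
    rw [← diagonalPart_of_mem_adjoin hW ha, coeff_diagonalPart]
    exact homogeneousComponent_isHomogeneous _ _
  refine Subtype.ext (Polynomial.ext fun k => ?_)
  have h := congrArg (homogeneousComponent (d * k)) hsum
  have hterm : ∀ j, homogeneousComponent (d * k) (a.coeff j) =
      if j = k then a.coeff k else 0 := fun j => by
    rw [homogeneousComponent_of_mem (hcoeff j)]
    by_cases hj : j = k
    · simp [hj]
    · rw [if_neg, if_neg hj]
      exact fun e => hj (Nat.eq_of_mul_eq_mul_left (Nat.pos_of_ne_zero hd) e).symm
  simp only [map_sum, hterm, map_zero, Finset.sum_ite_eq'] at h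
  by_contra hk
  rw [if_pos (Polynomial.mem_support_iff.mpr hk)] at h
  exact hk h

/-- If `W` consists of homogeneous polynomials of the same degree and a subalgebra lying between
`R[W z]` and `R[t][W z]` is integrally closed, then so is `R[W z]`. -/
theorem isIntegrallyClosed_adjoin_degreeOneGenerators [IsDomain R] {d : ℕ}
    {W : Set (MvPolynomial σ R)} (hW : ∀ w ∈ W, w.IsHomogeneous d)
    (B : Subalgebra R (Polynomial (MvPolynomial σ R))) [IsIntegrallyClosed B]
    (hle : Algebra.adjoin R (degreeOneGenerators W) ≤ B)
    (hB : ∀ r ∈ B, r ∈ Algebra.adjoin (MvPolynomial σ R) (degreeOneGenerators W)) :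
    IsIntegrallyClosed (Algebra.adjoin R (degreeOneGenerators W)) := by
  let f : Algebra.adjoin R (degreeOneGenerators W) →+* B := (Subalgebra.inclusion hle).toRingHom
  have hf : Function.Injective f := Subalgebra.inclusion_injective hle
  refine IsIntegrallyClosed.of_injective_of_dvd_descends
    (A := Algebra.adjoin R (degreeOneGenerators W)) (B := B) f hf fun a b hab => ?_
  obtain ⟨r, hr⟩ := hab
  have hr' : (a : Polynomial (MvPolynomial σ R)) = b * r := congrArg Subtype.val hr
  refine ⟨⟨diagonalPart d r, diagonalPart_mem_adjoin hW (hB r r.2)⟩, Subtype.ext ?_⟩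
  rw [MulMemClass.coe_mul, ← diagonalPart_mul_of_mem_adjoin hW b.2, ← hr',
    diagonalPart_of_mem_adjoin hW a.2]

theorem isIntegrallyClosed_adjoin_of_isHomogeneous_zero {K : Type*} [Field K]
    {W : Set (MvPolynomial σ K)} (hW : ∀ w ∈ W, w.IsHomogeneous 0) :
    IsIntegrallyClosed (Algebra.adjoin K W) := by
  have hbot : Algebra.adjoin K W = ⊥ := by
    rw [eq_bot_iff, Algebra.adjoin_le_iff]
    intro w hw
    refine Algebra.mem_bot.mpr ⟨coeff 0 w, ?_⟩
    exact (totalDegree_eq_zero_iff_eq_C.mp ((totalDegree_zero_iff_isHomogeneous _).mpr (hW w hw))).symm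
  rw [hbot]
  exact IsIntegrallyClosed.of_equiv (Algebra.botEquiv K (MvPolynomial σ K)).symm.toRingEquiv

end MvPolynomial

/-- **descent of normality.** Let `I ⊆ S = K[t_1,…,t_s]` be an ideal
generated by monomials `t^{v_1},…,t^{v_m}` all of total degree `d`.  If the Rees
algebra `S[Iz] ⊆ S[z]` is normal, then the monomial subring
`K[t^{v_1},…,t^{v_m}] ⊆ S` is normal. -/
theorem descent_of_normality
    {s m : ℕ} (K : Type*) [Field K] (d : ℕ)
    (v : Fin m → Fin s → ℕ)
    (hdeg : ∀ j : Fin m, ∑ i, v j i = d)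
    (I : Ideal (MvPolynomial (Fin s) K))
    (hI : I = Ideal.span {f : MvPolynomial (Fin s) K | ∃ j : Fin m, f = ∏ i, X i ^ v j i})
    (R₀ : Subalgebra K (Polynomial (MvPolynomial (Fin s) K)))
    (hR₀ : R₀ = Algebra.adjoin K
      ((Set.range fun i : Fin s => (Polynomial.C (X i) : Polynomial (MvPolynomial (Fin s) K))) ∪
       {p : Polynomial (MvPolynomial (Fin s) K) | ∃ f ∈ I, p = Polynomial.C f * Polynomial.X}))
    (hnormal : IsIntegrallyClosed R₀)
    (M : Subalgebra K (MvPolynomial (Fin s) K))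
    (hM : M = Algebra.adjoin K
      {f : MvPolynomial (Fin s) K | ∃ j : Fin m, f = ∏ i, X i ^ v j i}) :
    IsIntegrallyClosed M := by
  set W : Set (MvPolynomial (Fin s) K) := {f | ∃ j : Fin m, f = ∏ i, X i ^ v j i}
  have hW : ∀ w ∈ W, w.IsHomogeneous d := by
    rintro _ ⟨j, rfl⟩
    rw [← hdeg j]
    exact IsHomogeneous.prod _ _ _ fun i _ => isHomogeneous_X_pow i (v j i)
  subst hI hM
  rcases eq_or_ne d 0 with rfl | hd
  · exact isIntegrallyClosed_adjoin_of_isHomogeneous_zero hW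
  have hle : Algebra.adjoin K (degreeOneGenerators W) ≤ R₀ := by
    rw [hR₀]
    refine Algebra.adjoin_mono ?_
    rintro _ ⟨w, hw, rfl⟩
    exact Or.inr ⟨w, Ideal.subset_span hw, rfl⟩
  have hRees : R₀ ≤
      (Algebra.adjoin (MvPolynomial (Fin s) K) (degreeOneGenerators W)).restrictScalars K := by
    rw [hR₀, Algebra.adjoin_le_iff]
    rintro _ (⟨i, rfl⟩ | ⟨f, hf, rfl⟩)
    · exact Subalgebra.algebraMap_mem
        (Algebra.adjoin (MvPolynomial (Fin s) K) (degreeOneGenerators W)) (X i)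
    · exact C_mul_X_mem_adjoin_of_mem_span hf
  have := isIntegrallyClosed_adjoin_degreeOneGenerators hW R₀ hle hRees
  have e := AlgEquiv.ofInjective _ (evalOne_comp_val_injective hd hW)
  rw [Subalgebra.range_comp_val, map_evalOne_adjoin] at e
  exact IsIntegrallyClosed.of_equiv (R := Algebra.adjoin K (degreeOneGenerators W)) e.toRingEquiv
end

section
/- Let I ⊆ S = K[t_1,…,t_s] be a monomial ideal generated by monomials t^{v_1},…,t^{v_m}, and suppose there is a vector b ∈ ℚ^s with all entries b_i > 0 such that ⟨b, v_i⟩ = 1 for i = 1,…,m. Let P = conv(v_1,…,v_m) ⊆ ℝ^s be the convex hull of v_1,…,v_m. If the Rees algebra S[Iz] ⊆ S[z] is normal (integrally closed in its field of fractions), then the K-subalgebra K[t^{v_1}z,…,t^{v_m}z] of S[z] equals the Ehrhart ring A(P); in particular K[t^{v_1}z,…,t^{v_m}z] is normal. -/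
open MvPolynomial

section MonomialSubalgebra

variable {σ : Type*} (K : Type*) [Field K]

/-- The monomial `t^a z^n` of `S[z]`, where `e = (a, n)`. -/
noncomputable def bimonomial (e : (σ →₀ ℕ) × ℕ) : Polynomial (MvPolynomial σ K) :=
  Polynomial.monomial e.2 (MvPolynomial.monomial e.1 1)

/-- The polynomials in `S[z]` all of whose monomials `t^a z^n` have exponent `(a, n) ∈ T`. -/
def monomialSubmodule (T : Set ((σ →₀ ℕ) × ℕ)) :
    Submodule K (Polynomial (MvPolynomial σ K)) where
  carrier := {f | ∀ n a, (f.coeff n).coeff a ≠ 0 → (a, n) ∈ T}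
  zero_mem' n a h := by simp at h
  add_mem' {f g} hf hg n a h := by
    by_contra hT
    refine h ?_
    have h1 : (f.coeff n).coeff a = 0 := by_contra fun h' ↦ hT (hf n a h')
    have h2 : (g.coeff n).coeff a = 0 := by_contra fun h' ↦ hT (hg n a h')
    simp [h1, h2]
  smul_mem' c f hf n a h := by
    refine hf n a fun h' ↦ h ?_
    simp [h']

variable {K}

theorem mem_monomialSubmodule {T : Set ((σ →₀ ℕ) × ℕ)} {f : Polynomial (MvPolynomial σ K)} :
    f ∈ monomialSubmodule K T ↔ ∀ n a, (f.coeff n).coeff a ≠ 0 → (a, n) ∈ T :=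
  Iff.rfl

theorem coeff_coeff_bimonomial (e : (σ →₀ ℕ) × ℕ) (n : ℕ) (a : σ →₀ ℕ) [Decidable (e = (a, n))] :
    ((bimonomial K e).coeff n).coeff a = if e = (a, n) then 1 else 0 := by
  classical
  obtain ⟨c, k⟩ := e
  rw [bimonomial, Polynomial.coeff_monomial]
  by_cases hk : k = n
  · simp [hk, MvPolynomial.coeff_monomial]
  · simp [hk]

theorem bimonomial_mem_monomialSubmodule {T : Set ((σ →₀ ℕ) × ℕ)} {e : (σ →₀ ℕ) × ℕ} :
    bimonomial K e ∈ monomialSubmodule K T ↔ e ∈ T := by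
  classical
  simp only [mem_monomialSubmodule, coeff_coeff_bimonomial]
  refine ⟨fun h ↦ h e.2 e.1 (by simp), fun h n a hne ↦ ?_⟩
  rw [ne_eq, ite_eq_right_iff, Classical.not_imp] at hne
  exact hne.1 ▸ h

@[simp]
theorem bimonomial_zero : bimonomial K (0 : (σ →₀ ℕ) × ℕ) = 1 := by
  simp [bimonomial]

theorem bimonomial_add (e e' : (σ →₀ ℕ) × ℕ) :
    bimonomial K (e + e') = bimonomial K e * bimonomial K e' := by
  simp [bimonomial, Polynomial.monomial_mul_monomial, MvPolynomial.monomial_mul]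

theorem bimonomial_nsmul (k : ℕ) (e : (σ →₀ ℕ) × ℕ) :
    bimonomial K (k • e) = bimonomial K e ^ k := by
  induction k with
  | zero => simp
  | succ k ih => rw [succ_nsmul, bimonomial_add, ih, pow_succ]

theorem bimonomial_ne_zero (e : (σ →₀ ℕ) × ℕ) : bimonomial K e ≠ 0 := by
  simp [bimonomial]

theorem C_prod_mul_X_pow_eq_bimonomial [Fintype σ] (a : σ →₀ ℕ) (n : ℕ) :
    Polynomial.C (∏ i, X i ^ a i) * Polynomial.X ^ n = bimonomial K (a, n) := by
  rw [bimonomial, Polynomial.C_mul_X_pow_eq_monomial, MvPolynomial.monomial_eq,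
    Finsupp.prod_fintype _ _ (by simp), C_1, one_mul]

theorem monomialSubmodule_eq_span (T : Set ((σ →₀ ℕ) × ℕ)) :
    monomialSubmodule K T = Submodule.span K (bimonomial K '' T) := by
  refine le_antisymm (fun f hf ↦ ?_) (Submodule.span_le.mpr ?_)
  · rw [f.as_sum_support]
    refine Submodule.sum_mem _ fun n _ ↦ ?_
    rw [(f.coeff n).as_sum, map_sum]
    refine Submodule.sum_mem _ fun a ha ↦ ?_
    have : Polynomial.monomial n (MvPolynomial.monomial a ((f.coeff n).coeff a)) =
        (f.coeff n).coeff a • bimonomial K (a, n) := by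
      rw [bimonomial, Polynomial.smul_monomial, MvPolynomial.smul_monomial, smul_eq_mul, mul_one]
    rw [this]
    exact Submodule.smul_mem _ _ <| Submodule.subset_span
      ⟨_, hf n a (MvPolynomial.mem_support_iff.mp ha), rfl⟩
  · rintro _ ⟨e, he, rfl⟩
    exact bimonomial_mem_monomialSubmodule.mpr he

theorem mul_mem_monomialSubmodule {T U V : Set ((σ →₀ ℕ) × ℕ)}
    (h : ∀ t ∈ T, ∀ u ∈ U, t + u ∈ V) {f g : Polynomial (MvPolynomial σ K)}
    (hf : f ∈ monomialSubmodule K T) (hg : g ∈ monomialSubmodule K U) :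
    f * g ∈ monomialSubmodule K V := by
  rw [monomialSubmodule_eq_span] at hf hg
  have hfg := Submodule.mul_mem_mul hf hg
  rw [Submodule.span_mul_span] at hfg
  refine Submodule.span_le.mpr ?_ hfg
  rintro _ ⟨_, ⟨t, ht, rfl⟩, _, ⟨u, hu, rfl⟩, rfl⟩
  change bimonomial K t * bimonomial K u ∈ _
  rw [← bimonomial_add]
  exact bimonomial_mem_monomialSubmodule.mpr (h t ht u hu)

theorem eq_zero_of_mem_monomialSubmodule_compl {T : Set ((σ →₀ ℕ) × ℕ)}
    {f : Polynomial (MvPolynomial σ K)} (hf : f ∈ monomialSubmodule K T)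
    (hf' : f ∈ monomialSubmodule K Tᶜ) : f = 0 := by
  ext n a
  by_contra h
  exact hf' n a h (hf n a h)

theorem exists_add_mem_monomialSubmodule_compl (T : Set ((σ →₀ ℕ) × ℕ))
    (f : Polynomial (MvPolynomial σ K)) :
    ∃ g ∈ monomialSubmodule K T, ∃ h ∈ monomialSubmodule K Tᶜ, g + h = f := by
  rw [← Submodule.mem_sup, monomialSubmodule_eq_span, monomialSubmodule_eq_span,
    ← Submodule.span_union, ← Set.image_union, Set.union_compl_self, ← monomialSubmodule_eq_span]
  exact fun _ _ _ ↦ Set.mem_univ _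

theorem adjoin_bimonomial_toSubmodule (G : Set ((σ →₀ ℕ) × ℕ)) :
    Subalgebra.toSubmodule (Algebra.adjoin K (bimonomial K '' G)) =
      monomialSubmodule K (AddSubmonoid.closure G : Set ((σ →₀ ℕ) × ℕ)) := by
  refine le_antisymm (fun f hf ↦ ?_) ?_
  · induction hf using Algebra.adjoin_induction with
    | mem x hx =>
      obtain ⟨e, he, rfl⟩ := hx
      exact bimonomial_mem_monomialSubmodule.mpr (AddSubmonoid.subset_closure he)
    | algebraMap r =>
      rw [Algebra.algebraMap_eq_smul_one, ← bimonomial_zero (σ := σ)]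
      exact Submodule.smul_mem _ _ (bimonomial_mem_monomialSubmodule.mpr (zero_mem _))
    | add x y _ _ hx hy => exact add_mem hx hy
    | mul x y _ _ hx hy =>
      exact mul_mem_monomialSubmodule (fun t ht u hu ↦ add_mem ht hu) hx hy
  · rw [monomialSubmodule_eq_span, Submodule.span_le]
    rintro _ ⟨e, he, rfl⟩
    change bimonomial K e ∈ Algebra.adjoin K (bimonomial K '' G)
    induction he using AddSubmonoid.closure_induction with
    | mem x hx => exact Algebra.subset_adjoin ⟨x, hx, rfl⟩
    | zero => rw [bimonomial_zero]; exact one_mem _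
    | add x y _ _ hx hy => rw [bimonomial_add]; exact mul_mem hx hy

theorem mem_adjoin_bimonomial {G : Set ((σ →₀ ℕ) × ℕ)} {f : Polynomial (MvPolynomial σ K)} :
    f ∈ Algebra.adjoin K (bimonomial K '' G) ↔
      f ∈ monomialSubmodule K (AddSubmonoid.closure G : Set ((σ →₀ ℕ) × ℕ)) := by
  rw [← adjoin_bimonomial_toSubmodule, Subalgebra.mem_toSubmodule]

/-- If a nonzero `g` and the product `g * f` only involve monomials of weight zero, so does `f`. -/
theorem mem_monomialSubmodule_ker_of_mul_mem {M : Type*} [AddGroup M]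
    (w : (σ →₀ ℕ) × ℕ →+ M) {f g : Polynomial (MvPolynomial σ K)} (hg0 : g ≠ 0)
    (hg : g ∈ monomialSubmodule K {e | w e = 0})
    (hgf : g * f ∈ monomialSubmodule K {e | w e = 0}) :
    f ∈ monomialSubmodule K {e | w e = 0} := by
  obtain ⟨f₀, hf₀, f₁, hf₁, rfl⟩ := exists_add_mem_monomialSubmodule_compl {e | w e = 0} f
  have h₀ : g * f₀ ∈ monomialSubmodule K {e | w e = 0} :=
    mul_mem_monomialSubmodule (fun t ht u hu ↦ by
      simp_all only [Set.mem_ofPred_eq, map_add, add_zero]) hg hf₀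
  have h₁ : g * f₁ ∈ monomialSubmodule K {e | w e = 0} := by
    have := sub_mem hgf h₀
    rwa [mul_add, add_sub_cancel_left] at this
  have h₁' : g * f₁ ∈ monomialSubmodule K {e | w e = 0}ᶜ :=
    mul_mem_monomialSubmodule (fun t ht u hu ↦ by
      simp_all only [Set.mem_compl_iff, Set.mem_ofPred_eq, map_add, zero_add, not_false_eq_true])
      hg hf₁
  have : f₁ = 0 :=
    (mul_eq_zero.mp (eq_zero_of_mem_monomialSubmodule_compl h₁ h₁')).resolve_left hg0
  rwa [this, add_zero]

end MonomialSubalgebra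

section Normality

theorem IsIntegrallyClosed.of_injective_of_mul_eq {A R : Type*} [CommRing A] [IsDomain A]
    [CommRing R] [IsDomain R] [IsIntegrallyClosed R] (i : A →+* R) (hi : Function.Injective i)
    (h : ∀ f g : A, g ≠ 0 → ∀ r : R, i g * r = i f → ∃ a, i a = r) : IsIntegrallyClosed A := by
  rw [isIntegrallyClosed_iff (FractionRing A)]
  intro x hx
  let j : A →+* FractionRing R := (algebraMap R (FractionRing R)).comp i
  have hj : Function.Injective j := (IsFractionRing.injective R (FractionRing R)).comp hi
  let l : FractionRing A →+* FractionRing R := IsFractionRing.lift hj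
  have hl (a : A) : l (algebraMap A _ a) = algebraMap R _ (i a) :=
    IsFractionRing.lift_algebraMap hj a
  have hlx : IsIntegral R (l x) := hx.map_of_comp_eq i l (RingHom.ext fun a ↦ (hl a).symm)
  obtain ⟨r, hr⟩ := IsIntegrallyClosed.algebraMap_eq_of_integral hlx
  obtain ⟨f, g, hg, rfl⟩ := IsFractionRing.div_surjective (A := A) x
  have hg0 : g ≠ 0 := nonZeroDivisors.ne_zero hg
  have hig : algebraMap R (FractionRing R) (i g) ≠ 0 := by
    rw [← hl]; simpa using hg0
  obtain ⟨a, rfl⟩ := h f g hg0 r <| IsFractionRing.injective R (FractionRing R) <| by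
    rw [map_mul, hr, map_div₀, hl, hl, mul_div_cancel₀ _ hig]
  exact ⟨a, l.injective (by rw [hl, hr])⟩

theorem IsIntegrallyClosed.of_subalgebra_le {k B : Type*} [CommRing k] [CommRing B] [IsDomain B]
    [Algebra k B] {A R : Subalgebra k B} [IsIntegrallyClosed R] (hle : A ≤ R)
    (h : ∀ f ∈ A, ∀ g ∈ A, g ≠ 0 → ∀ r ∈ R, g * r = f → r ∈ A) : IsIntegrallyClosed A := by
  refine IsIntegrallyClosed.of_injective_of_mul_eq (R := R) (Subalgebra.inclusion hle).toRingHom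
    (Subalgebra.inclusion_injective hle) fun f g hg0 r hr ↦ ?_
  exact ⟨⟨r, h f f.2 g g.2 (fun h ↦ hg0 (Subtype.ext h)) r r.2 (congrArg Subtype.val hr)⟩, rfl⟩

theorem IsIntegrallyClosed.mem_subalgebra_of_pow_mem {k B : Type*} [CommRing k] [CommRing B]
    [IsDomain B] [Algebra k B] (R : Subalgebra k B) [IsIntegrallyClosed R] {y d : B} {n : ℕ}
    (hn : 0 < n) (hy : y ^ n ∈ R) (hd : d ∈ R) (hd0 : d ≠ 0) (hdy : d * y ∈ R) : y ∈ R := by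
  let L := FractionRing R
  let D : R := ⟨d, hd⟩
  let E : R := ⟨d * y, hdy⟩
  let Y : R := ⟨y ^ n, hy⟩
  have hD : algebraMap R L D ≠ 0 := by
    simpa [D, Subtype.ext_iff] using hd0
  have hpow : E ^ n = D ^ n * Y := Subtype.ext (mul_pow d y n)
  obtain ⟨r, hr⟩ := IsIntegrallyClosed.exists_algebraMap_eq_of_isIntegral_pow (R := R)
    (x := algebraMap R L E / algebraMap R L D) hn (by
      rw [div_pow, ← map_pow, hpow, map_mul, map_pow, mul_div_cancel_left₀ _ (pow_ne_zero _ hD)]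
      exact isIntegral_algebraMap)
  have hEr : D * r = E := IsFractionRing.injective R L <| by
    rw [map_mul, hr, mul_div_cancel₀ _ hD]
  have : y = r := mul_left_cancel₀ hd0 (congrArg Subtype.val hEr).symm
  exact this ▸ r.2

end Normality

section Polytope

/-- A natural vector in the real cone over finitely many natural vectors has a positive multiple
that is a nonnegative integral combination of them. -/
theorem exists_nsmul_eq_sum_of_real_combination {ι σ : Type*} [Fintype ι] [Finite σ]
    (v : ι → σ → ℕ) (a : σ → ℕ) (μ : ι → ℝ) (hμ : ∀ j, 0 ≤ μ j)
    (ha : ∀ i, (a i : ℝ) = ∑ j, μ j * v j i) :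
    ∃ D : ℕ, 0 < D ∧ ∃ c : ι → ℕ, ∀ i, D * a i = ∑ j, c j * v j i := by
  let q (N : ℕ) (i : σ) : ℕ := ∑ j, ⌊N * μ j⌋₊ * v j i
  have hq (N i) : q N i ≤ N * a i := by
    have : ((q N i : ℕ) : ℝ) ≤ (N * a i : ℕ) := by
      push_cast [q]
      rw [ha, Finset.mul_sum]
      refine Finset.sum_le_sum fun j _ ↦ ?_
      rw [← mul_assoc]
      exact mul_le_mul_of_nonneg_right
        (Nat.floor_le (mul_nonneg N.cast_nonneg (hμ j))) (Nat.cast_nonneg _)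
    exact_mod_cast this
  have hr (N i) : N * a i - q N i < (∑ j, v j i) + 1 := by
    have : ((N * a i : ℕ) : ℝ) ≤ (q N i + ∑ j, v j i : ℕ) := by
      push_cast [q]
      rw [ha, Finset.mul_sum, ← Finset.sum_add_distrib]
      refine Finset.sum_le_sum fun j _ ↦ ?_
      rw [← mul_assoc, ← add_one_mul]
      exact mul_le_mul_of_nonneg_right (Nat.lt_floor_add_one _).le (Nat.cast_nonneg _)
    have : N * a i ≤ q N i + ∑ j, v j i := by exact_mod_cast this
    omega
  let r (N : ℕ) : (i : σ) → Fin ((∑ j, v j i) + 1) := fun i ↦ ⟨N * a i - q N i, hr N i⟩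
  obtain ⟨M, N, hlt, hMN⟩ : ∃ M N, M < N ∧ r M = r N := by
    obtain ⟨M, N, hne, h⟩ := Finite.exists_ne_map_eq_of_infinite r
    rcases hne.lt_or_gt with hlt | hlt
    · exact ⟨M, N, hlt, h⟩
    · exact ⟨N, M, hlt, h.symm⟩
  refine ⟨N - M, Nat.sub_pos_of_lt hlt, fun j ↦ ⌊N * μ j⌋₊ - ⌊M * μ j⌋₊, fun i ↦ ?_⟩
  have hi : M * a i - q M i = N * a i - q N i := congrArg Fin.val (congrFun hMN i)
  have hsum : (∑ j, (⌊N * μ j⌋₊ - ⌊M * μ j⌋₊) * v j i) + q M i = q N i := by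
    rw [← Finset.sum_add_distrib]
    refine Finset.sum_congr rfl fun j _ ↦ ?_
    rw [← add_mul, Nat.sub_add_cancel]
    exact Nat.floor_le_floor
      (mul_le_mul_of_nonneg_right (Nat.cast_le.mpr hlt.le) (hμ j))
  have := hq M i
  have := hq N i
  rw [Nat.sub_mul]
  beta_reduce
  omega

theorem mem_convexHull_range_iff {ι E : Type*} [Fintype ι] [AddCommGroup E] [Module ℝ E]
    {v : ι → E} {x : E} : x ∈ convexHull ℝ (Set.range v) ↔
      ∃ μ : ι → ℝ, (∀ j, 0 ≤ μ j) ∧ ∑ j, μ j = 1 ∧ ∑ j, μ j • v j = x := by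
  classical
  refine ⟨fun h ↦ ?_, fun ⟨μ, hμ, hμ1, hx⟩ ↦
    mem_convexHull_of_exists_fintype μ v hμ hμ1 (fun j ↦ ⟨j, rfl⟩) hx⟩
  have hv : Set.range v = Fintype.linearCombination ℝ v ''
      Set.range fun i j : ι ↦ if i = j then (1 : ℝ) else 0 := by
    rw [← Set.range_comp]
    congr 1
    ext j
    simp [Fintype.linearCombination_apply]
  rw [hv, ← LinearMap.image_convexHull, convexHull_basis_eq_stdSimplex] at h
  obtain ⟨μ, ⟨hμ, hμ1⟩, rfl⟩ := h
  exact ⟨μ, hμ, hμ1, (Fintype.linearCombination_apply ℝ v μ).symm⟩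

theorem exists_mem_convexHull_eq_nsmul_iff {ι σ : Type*} [Fintype ι] [Nonempty ι]
    {v : ι → σ → ℕ} {n : ℕ} {a : σ → ℕ} :
    (∃ x ∈ convexHull ℝ (Set.range fun j : ι ↦ fun i : σ ↦ (v j i : ℝ)),
        (fun i : σ ↦ (a i : ℝ)) = (n : ℝ) • x) ↔
      ∃ μ : ι → ℝ, (∀ j, 0 ≤ μ j) ∧ ∑ j, μ j = n ∧ ∀ i, (a i : ℝ) = ∑ j, μ j * v j i := by
  constructor
  · rintro ⟨x, hx, ha⟩
    obtain ⟨μ, hμ, hμ1, rfl⟩ := mem_convexHull_range_iff.mp hx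
    refine ⟨fun j ↦ n * μ j, fun j ↦ mul_nonneg n.cast_nonneg (hμ j), ?_, fun i ↦ ?_⟩
    · rw [← Finset.mul_sum, hμ1, mul_one]
    · simpa [Finset.mul_sum, mul_assoc] using congrFun ha i
  · rintro ⟨μ, hμ, hμn, ha⟩
    rcases n.eq_zero_or_pos with rfl | hn
    · have hμ0 : ∀ j, μ j = 0 := by
        simpa [Finset.sum_eq_zero_iff_of_nonneg fun j _ ↦ hμ j] using hμn
      refine ⟨_, subset_convexHull ℝ _ ⟨Classical.arbitrary ι, rfl⟩, funext fun i ↦ ?_⟩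
      simp [ha, hμ0]
    · have hn0 : (n : ℝ) ≠ 0 := by positivity
      refine ⟨(n : ℝ)⁻¹ • fun i ↦ (a i : ℝ), mem_convexHull_range_iff.mpr
        ⟨fun j ↦ (n : ℝ)⁻¹ * μ j, fun j ↦ mul_nonneg (by positivity) (hμ j), ?_, ?_⟩, ?_⟩
      · rw [← Finset.mul_sum, hμn, inv_mul_cancel₀ hn0]
      · ext i
        simp [ha, Finset.mul_sum, mul_assoc]
      · rw [smul_inv_smul₀ hn0]

end Polytope

section Exponents

variable {ι σ : Type*} [Fintype σ] (b : σ → ℚ)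

/-- The exponents `(v_j, 1)` of the monomials `t^{v_j} z`. -/
def edgeExponents (v : ι → σ → ℕ) : Set ((σ →₀ ℕ) × ℕ) :=
  Set.range fun j ↦ (Finsupp.equivFunOnFinite.symm (v j), 1)

/-- The exponents `(v_j, 1)` of the monomials `t^{v_j} z` and `(e_i, 0)` of the variables `t_i`. -/
def reesExponents (v : ι → σ → ℕ) : Set ((σ →₀ ℕ) × ℕ) :=
  edgeExponents v ∪ Set.range fun i ↦ (Finsupp.single i 1, 0)

/-- The weight `⟨b, a⟩ - n` of an exponent `(a, n)`. -/
def exponentWeight : (σ →₀ ℕ) × ℕ →+ ℚ where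
  toFun e := ∑ i, b i * e.1 i - e.2
  map_zero' := by simp
  map_add' e e' := by
    simp only [Prod.fst_add, Prod.snd_add, Finsupp.add_apply, Nat.cast_add, mul_add,
      Finset.sum_add_distrib]
    ring

variable {b} {v : ι → σ → ℕ}

theorem exponentWeight_edge (hbv : ∀ j, ∑ i, b i * (v j i : ℚ) = 1) (j : ι) :
    exponentWeight b (Finsupp.equivFunOnFinite.symm (v j), 1) = 0 := by
  simp [exponentWeight, hbv]

theorem exponentWeight_eq_zero_of_mem_closure (hbv : ∀ j, ∑ i, b i * (v j i : ℚ) = 1)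
    {e : (σ →₀ ℕ) × ℕ} (he : e ∈ AddSubmonoid.closure (edgeExponents v)) :
    exponentWeight b e = 0 := by
  have : AddSubmonoid.closure (edgeExponents v) ≤ AddMonoidHom.mker (exponentWeight b) := by
    rw [AddSubmonoid.closure_le]
    rintro _ ⟨j, rfl⟩
    exact exponentWeight_edge hbv j
  exact this he

theorem mem_closure_edgeExponents_of_exponentWeight_eq_zero (hb : ∀ i, 0 < b i)
    (hbv : ∀ j, ∑ i, b i * (v j i : ℚ) = 1) {e : (σ →₀ ℕ) × ℕ}
    (he : e ∈ AddSubmonoid.closure (reesExponents v)) (h0 : exponentWeight b e = 0) :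
    e ∈ AddSubmonoid.closure (edgeExponents v) := by
  classical
  suffices 0 ≤ exponentWeight b e ∧
      (exponentWeight b e = 0 → e ∈ AddSubmonoid.closure (edgeExponents v)) from this.2 h0
  clear h0
  induction he using AddSubmonoid.closure_induction with
  | mem x hx =>
    rcases hx with ⟨j, rfl⟩ | ⟨i, rfl⟩
    · exact ⟨(exponentWeight_edge hbv j).ge, fun _ ↦ AddSubmonoid.subset_closure ⟨j, rfl⟩⟩
    · have : exponentWeight b (Finsupp.single i 1, 0) = b i := by
        simp [exponentWeight, Finsupp.single_apply]
      rw [this]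
      exact ⟨(hb i).le, fun h ↦ absurd h (hb i).ne'⟩
  | zero => exact ⟨(map_zero _).ge, fun _ ↦ zero_mem _⟩
  | add x y _ _ hx hy =>
    rw [map_add]
    refine ⟨add_nonneg hx.1 hy.1, fun h ↦ ?_⟩
    rw [add_eq_zero_iff_of_nonneg hx.1 hy.1] at h
    exact add_mem (hx.2 h.1) (hy.2 h.2)

theorem exists_real_combination_of_mem_closure [Fintype ι] {e : (σ →₀ ℕ) × ℕ}
    (he : e ∈ AddSubmonoid.closure (edgeExponents v)) :
    ∃ μ : ι → ℝ, (∀ j, 0 ≤ μ j) ∧ ∑ j, μ j = e.2 ∧ ∀ i, (e.1 i : ℝ) = ∑ j, μ j * v j i := by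
  classical
  induction he using AddSubmonoid.closure_induction with
  | mem x hx =>
    obtain ⟨j, rfl⟩ := hx
    refine ⟨Pi.single j 1, fun k ↦ ?_, by simp, fun i ↦ ?_⟩
    · rw [Pi.single_apply]
      split_ifs <;> norm_num
    · simp [Pi.single_apply]
  | zero => exact ⟨0, fun _ ↦ le_rfl, by simp, by simp⟩
  | add x y _ _ hx hy =>
    obtain ⟨μ, hμ, hμn, hx⟩ := hx
    obtain ⟨ν, hν, hνn, hy⟩ := hy
    refine ⟨μ + ν, fun j ↦ add_nonneg (hμ j) (hν j), ?_, fun i ↦ ?_⟩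
    · simp [Finset.sum_add_distrib, hμn, hνn]
    · simp [Finset.sum_add_distrib, add_mul, hx, hy]

theorem exists_nsmul_mem_closure_edgeExponents [Fintype ι]
    (hbv : ∀ j, ∑ i, b i * (v j i : ℚ) = 1) {e : (σ →₀ ℕ) × ℕ} {μ : ι → ℝ} (hμ : ∀ j, 0 ≤ μ j)
    (h0 : exponentWeight b e = 0) (ha : ∀ i, (e.1 i : ℝ) = ∑ j, μ j * v j i) :
    ∃ D : ℕ, 0 < D ∧ D • e ∈ AddSubmonoid.closure (edgeExponents v) := by
  obtain ⟨D, hD, c, hc⟩ := exists_nsmul_eq_sum_of_real_combination v e.1 μ hμ ha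
  refine ⟨D, hD, ?_⟩
  let f := ∑ j, c j • ((Finsupp.equivFunOnFinite.symm (v j), 1) : (σ →₀ ℕ) × ℕ)
  have hf : f ∈ AddSubmonoid.closure (edgeExponents v) :=
    sum_mem fun j _ ↦ nsmul_mem (AddSubmonoid.subset_closure (Set.mem_range_self j)) _
  have h1 : (D • e).1 = f.1 := by
    ext i
    simp [f, Prod.fst_sum, Finsupp.finsetSum_apply, hc]
  have hw : exponentWeight b (D • e) = exponentWeight b f := by
    rw [exponentWeight_eq_zero_of_mem_closure hbv hf, map_nsmul, h0, nsmul_zero]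
  have h2 : (D • e).2 = f.2 := by
    have : ∑ i, b i * (D • e).1 i - (D • e).2 = ∑ i, b i * f.1 i - f.2 := hw
    rw [h1, sub_right_inj] at this
    exact_mod_cast this
  rwa [Prod.ext h1 h2]

/-- The weight of a point of the cone over `conv(v_1, …, v_m)` at height `n` vanishes. -/
theorem exponentWeight_eq_zero_of_real_combination [Fintype ι]
    (hbv : ∀ j, ∑ i, b i * (v j i : ℚ) = 1) {e : (σ →₀ ℕ) × ℕ} {μ : ι → ℝ}
    (hμ : ∑ j, μ j = e.2) (ha : ∀ i, (e.1 i : ℝ) = ∑ j, μ j * v j i) :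
    exponentWeight b e = 0 := by
  have hbv' (j) : ∑ i, (b i : ℝ) * (v j i : ℝ) = 1 := by exact_mod_cast hbv j
  have : ∑ i, (b i : ℝ) * (e.1 i : ℝ) = e.2 := by
    simp_rw [ha, Finset.mul_sum]
    rw [Finset.sum_comm, ← hμ]
    refine Finset.sum_congr rfl fun j _ ↦ ?_
    simp_rw [mul_left_comm, ← Finset.mul_sum]
    rw [hbv', mul_one]
  have : ∑ i, b i * (e.1 i : ℚ) = e.2 := by exact_mod_cast this
  exact sub_eq_zero.mpr this

end Exponents

theorem adjoin_reesExponents {σ ι K : Type*} [Fintype σ] [Field K] (v : ι → σ → ℕ) :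
    Algebra.adjoin K
      ((Set.range fun i : σ ↦ (Polynomial.C (X i) : Polynomial (MvPolynomial σ K))) ∪
       {p | ∃ f ∈ Ideal.span {f : MvPolynomial σ K | ∃ j : ι, f = ∏ i, X i ^ v j i},
          p = Polynomial.C f * Polynomial.X}) =
      Algebra.adjoin K (bimonomial K '' reesExponents v) := by
  set B := Algebra.adjoin K (bimonomial K '' reesExponents v) with hB
  have hX (i : σ) : bimonomial K (Finsupp.single i 1, 0) = Polynomial.C (X i) := rfl
  have hv (j : ι) : bimonomial K (Finsupp.equivFunOnFinite.symm (v j), 1) =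
      Polynomial.C (∏ i, X i ^ v j i) * Polynomial.X := by
    rw [← C_prod_mul_X_pow_eq_bimonomial, pow_one]; rfl
  have hC (g : MvPolynomial σ K) : Polynomial.C g ∈ B := by
    induction g using MvPolynomial.induction_on with
    | C a => exact B.algebraMap_mem a
    | add p q hp hq => rw [map_add]; exact add_mem hp hq
    | mul_X p i hp =>
      rw [map_mul, ← hX]
      exact mul_mem hp (Algebra.subset_adjoin ⟨_, Or.inr ⟨i, rfl⟩, rfl⟩)
  refine le_antisymm (Algebra.adjoin_le ?_) (Algebra.adjoin_mono ?_)
  · rintro _ (⟨i, rfl⟩ | ⟨f, hf, rfl⟩)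
    · exact hC _
    · change _ ∈ B
      induction hf using Submodule.span_induction with
      | mem x hx =>
        obtain ⟨j, rfl⟩ := hx
        rw [← hv]
        exact Algebra.subset_adjoin ⟨_, Or.inl ⟨j, rfl⟩, rfl⟩
      | zero => simp
      | add x y _ _ hx hy => rw [map_add, add_mul]; exact add_mem hx hy
      | smul a x _ hx => rw [smul_eq_mul, map_mul, mul_assoc]; exact mul_mem (hC a) hx
  · rintro _ ⟨_, ⟨j, rfl⟩ | ⟨i, rfl⟩, rfl⟩
    · exact Or.inr ⟨_, Ideal.subset_span ⟨j, rfl⟩, hv j⟩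
    · exact Or.inl ⟨i, rfl⟩

theorem adjoin_edgeExponents {σ ι K : Type*} [Fintype σ] [Field K] (v : ι → σ → ℕ) :
    Algebra.adjoin K {p : Polynomial (MvPolynomial σ K) |
        ∃ j : ι, p = Polynomial.C (∏ i, X i ^ v j i) * Polynomial.X} =
      Algebra.adjoin K (bimonomial K '' edgeExponents v) := by
  congr 1
  rw [edgeExponents, ← Set.range_comp]
  ext p
  refine exists_congr fun j ↦ ?_
  rw [Function.comp_apply, ← C_prod_mul_X_pow_eq_bimonomial, pow_one]
  exact eq_comm

/-- Once the Rees algebra is normal, a lattice point of `n P` is a sum of `n` of the `v_j`. -/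
theorem mem_closure_edgeExponents_iff {σ ι K : Type*} [Fintype σ] [Fintype ι] [Nonempty ι]
    [Field K] {b : σ → ℚ} {v : ι → σ → ℕ} (hb : ∀ i, 0 < b i)
    (hbv : ∀ j, ∑ i, b i * (v j i : ℚ) = 1)
    [IsIntegrallyClosed (Algebra.adjoin K (bimonomial K '' reesExponents v))]
    {e : (σ →₀ ℕ) × ℕ} :
    e ∈ AddSubmonoid.closure (edgeExponents v) ↔
      ∃ μ : ι → ℝ, (∀ j, 0 ≤ μ j) ∧ ∑ j, μ j = e.2 ∧ ∀ i, (e.1 i : ℝ) = ∑ j, μ j * v j i := by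
  refine ⟨exists_real_combination_of_mem_closure, fun ⟨μ, hμ, hμn, ha⟩ ↦ ?_⟩
  have h0 := exponentWeight_eq_zero_of_real_combination hbv hμn ha
  obtain ⟨D, hD, hDe⟩ := exists_nsmul_mem_closure_edgeExponents hbv hμ h0 ha
  have hsub : AddSubmonoid.closure (edgeExponents v) ≤ AddSubmonoid.closure (reesExponents v) :=
    AddSubmonoid.closure_mono Set.subset_union_left
  have hmem {e} : bimonomial K e ∈ Algebra.adjoin K (bimonomial K '' reesExponents v) ↔
      e ∈ AddSubmonoid.closure (reesExponents v) := by
    rw [mem_adjoin_bimonomial, bimonomial_mem_monomialSubmodule]; rfl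
  have hfst (a : σ →₀ ℕ) : (a, 0) ∈ AddSubmonoid.closure (reesExponents v) := by
    induction a using Finsupp.induction_linear with
    | zero => exact zero_mem _
    | add f g hf hg => simpa using add_mem hf hg
    | single i n =>
      have := nsmul_mem (AddSubmonoid.subset_closure
        (show (Finsupp.single i 1, 0) ∈ reesExponents v from Or.inr ⟨i, rfl⟩)) n
      simpa using this
  let j : ι := Classical.arbitrary ι
  let d : (σ →₀ ℕ) × ℕ := (e.2 • Finsupp.equivFunOnFinite.symm (v j), 0)
  have hde : d + e ∈ AddSubmonoid.closure (reesExponents v) := by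
    have : d + e = e.2 • ((Finsupp.equivFunOnFinite.symm (v j), 1) : (σ →₀ ℕ) × ℕ) + (e.1, 0) := by
      ext <;> simp [d]
    rw [this]
    exact add_mem (nsmul_mem (hsub (AddSubmonoid.subset_closure ⟨j, rfl⟩)) _) (hfst _)
  refine mem_closure_edgeExponents_of_exponentWeight_eq_zero hb hbv (hmem.mp ?_) h0
  refine IsIntegrallyClosed.mem_subalgebra_of_pow_mem _ hD (d := bimonomial K d) ?_
    (hmem.mpr (hfst _)) (bimonomial_ne_zero d) ?_
  · rw [← bimonomial_nsmul]
    exact hmem.mpr (hsub hDe)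
  · rw [← bimonomial_add]
    exact hmem.mpr hde

theorem isIntegrallyClosed_adjoin_edgeExponents {σ ι K : Type*} [Fintype σ]
    [Field K] {b : σ → ℚ} {v : ι → σ → ℕ} (hb : ∀ i, 0 < b i)
    (hbv : ∀ j, ∑ i, b i * (v j i : ℚ) = 1)
    [IsIntegrallyClosed (Algebra.adjoin K (bimonomial K '' reesExponents v))] :
    IsIntegrallyClosed (Algebra.adjoin K (bimonomial K '' edgeExponents v)) := by
  have hle : Algebra.adjoin K (bimonomial K '' edgeExponents v) ≤
      Algebra.adjoin K (bimonomial K '' reesExponents v) :=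
    Algebra.adjoin_mono (Set.image_mono Set.subset_union_left)
  have hw {x : Polynomial (MvPolynomial σ K)}
      (hx : x ∈ Algebra.adjoin K (bimonomial K '' edgeExponents v)) :
      x ∈ monomialSubmodule K {e | exponentWeight b e = 0} := fun n a h ↦
    exponentWeight_eq_zero_of_mem_closure hbv (mem_adjoin_bimonomial.mp hx n a h)
  refine IsIntegrallyClosed.of_subalgebra_le hle fun f hf g hg hg0 r hr h ↦ ?_
  have hrw : r ∈ monomialSubmodule K {e | exponentWeight b e = 0} :=
    mem_monomialSubmodule_ker_of_mul_mem _ hg0 (hw hg) (h ▸ hw hf)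
  exact mem_adjoin_bimonomial.mpr fun n a hna ↦
    mem_closure_edgeExponents_of_exponentWeight_eq_zero hb hbv
      (mem_adjoin_bimonomial.mp hr n a hna) (hrw n a hna)

/-- **generalized descent of normality.** Let `I ⊆ S = K[t_1,…,t_s]` be a
monomial ideal generated by `t^{v_1},…,t^{v_m}`, and suppose there is `b ∈ ℚ^s` with all
entries positive such that `⟨b, v_j⟩ = 1` for all `j`.  Let
`P = conv(v_1,…,v_m) ⊆ ℝ^s`.  If the Rees algebra `S[Iz] ⊆ S[z]` is normal, then the
`K`-subalgebra `K[t^{v_1}z,…,t^{v_m}z]` of `S[z]` equals the Ehrhart ring `A(P)` (the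
`K`-span of the monomials `t^a z^n` with `a ∈ nP ∩ ℤ^s`); in particular
`K[t^{v_1}z,…,t^{v_m}z]` is normal. -/
theorem generalized_descent_of_normality
    {s m : ℕ} (K : Type*) [Field K] (hm : 0 < m)
    (v : Fin m → Fin s → ℕ)
    (b : Fin s → ℚ) (hb : ∀ i, 0 < b i)
    (hbv : ∀ j : Fin m, ∑ i, b i * (v j i : ℚ) = 1)
    (I : Ideal (MvPolynomial (Fin s) K))
    (hI : I = Ideal.span {f : MvPolynomial (Fin s) K | ∃ j : Fin m, f = ∏ i, X i ^ v j i})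
    (R₀ : Subalgebra K (Polynomial (MvPolynomial (Fin s) K)))
    (hR₀ : R₀ = Algebra.adjoin K
      ((Set.range fun i : Fin s => (Polynomial.C (X i) : Polynomial (MvPolynomial (Fin s) K))) ∪
       {p : Polynomial (MvPolynomial (Fin s) K) | ∃ f ∈ I, p = Polynomial.C f * Polynomial.X}))
    (hnormal : IsIntegrallyClosed R₀)
    -- the subring `K[t^{v_1}z,…,t^{v_m}z]`:
    (A₀ : Subalgebra K (Polynomial (MvPolynomial (Fin s) K)))
    (hA₀ : A₀ = Algebra.adjoin K
      {p : Polynomial (MvPolynomial (Fin s) K) |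
        ∃ j : Fin m, p = Polynomial.C (∏ i, X i ^ v j i) * Polynomial.X})
    -- the Ehrhart ring `A(P)` of `P = conv(v_1,…,v_m)`, as a `K`-submodule of `S[z]`:
    (EhrhartSpan : Submodule K (Polynomial (MvPolynomial (Fin s) K)))
    (hE : EhrhartSpan = Submodule.span K
      {p : Polynomial (MvPolynomial (Fin s) K) |
        ∃ (n : ℕ) (a : Fin s → ℕ),
          (∃ x ∈ convexHull ℝ (Set.range fun j : Fin m => fun i : Fin s => (v j i : ℝ)),
            (fun i : Fin s => (a i : ℝ)) = (n : ℝ) • x) ∧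
          p = Polynomial.C (∏ i, X i ^ a i) * Polynomial.X ^ n}) :
    (A₀ : Set (Polynomial (MvPolynomial (Fin s) K))) =
        (EhrhartSpan : Set (Polynomial (MvPolynomial (Fin s) K))) ∧
      IsIntegrallyClosed A₀ := by
  have : Nonempty (Fin m) := ⟨⟨0, hm⟩⟩
  subst hI hR₀ hA₀ hE
  rw [adjoin_reesExponents] at hnormal
  rw [adjoin_edgeExponents]
  refine ⟨?_, isIntegrallyClosed_adjoin_edgeExponents hb hbv⟩
  rw [← Subalgebra.coe_toSubmodule, adjoin_bimonomial_toSubmodule, monomialSubmodule_eq_span]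
  congr 2
  ext p
  constructor
  · rintro ⟨e, he, rfl⟩
    exact ⟨e.2, e.1, exists_mem_convexHull_eq_nsmul_iff.mpr
      ((mem_closure_edgeExponents_iff (K := K) hb hbv).mp he),
      (C_prod_mul_X_pow_eq_bimonomial _ _).symm⟩
  · rintro ⟨n, a, ha, rfl⟩
    exact ⟨(Finsupp.equivFunOnFinite.symm a, n), (mem_closure_edgeExponents_iff (K := K) hb hbv).mpr
      (exists_mem_convexHull_eq_nsmul_iff.mp ha), (C_prod_mul_X_pow_eq_bimonomial _ _).symm⟩
end
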